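/- arXiv:1112.4122 — 10 statements merged into one kernel-verified Lean document; each statement's English description precedes it below -/
import Mathlib

section
/- Let a < b be real numbers and let r and s be positive continuous functions on the interval (a,b). Then for every nonnegative measurable function f on (a,b) for which all the integrals below exist and are finite, (∫_a^b r(x)(∫_a^x f(t) dt) dx)² ≤ (∫_a^b R(x,b)²/s(x) dx) · (∫_a^b s(x) f(x)² dx). -/
open MeasureTheory intervalIntegral Set

/-- Swapping the order of integration over the triangle `a < t ≤ x ≤ b`. -/
theorem integral_mul_primitive_eq_integral_mul_tail {a b : ℝ} (hab : a ≤ b) {r f : ℝ → ℝ}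
    (hr : IntervalIntegrable r volume a b) (hf : IntervalIntegrable f volume a b) :
    ∫ x in a..b, r x * ∫ t in a..x, f t = ∫ t in a..b, (∫ x in t..b, r x) * f t := by
  rw [intervalIntegrable_iff_integrableOn_Ioc_of_le hab] at hr hf
  have hint := (Integrable.mul_prod hr hf).indicator
    (measurableSet_le (measurable_snd (α := ℝ) (β := ℝ)) measurable_fst)
  have hswap := integral_integral_swap
    (f := fun x t => {p : ℝ × ℝ | p.2 ≤ p.1}.indicator (fun p => r p.1 * f p.2) (x, t)) hint
  rw [integral_of_le hab, integral_of_le hab]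
  convert hswap using 1
  · refine setIntegral_congr_fun measurableSet_Ioc fun x hx => ?_
    have hset : Ioc a b ∩ Iic x = Ioc a x := by
      rw [Ioc_inter_Iic, min_eq_right hx.2]
    calc r x * ∫ t in a..x, f t = ∫ t in Ioc a b ∩ Iic x, r x * f t := by
          rw [integral_of_le hx.1.le, hset, MeasureTheory.integral_const_mul]
      _ = _ := by
          rw [← setIntegral_indicator measurableSet_Iic]
          rfl
  · refine setIntegral_congr_fun measurableSet_Ioc fun t ht => ?_
    have hset : Ioc a b ∩ Ici t = Icc t b := by
      ext x
      exact ⟨fun h => ⟨h.2, h.1.2⟩, fun h => ⟨⟨ht.1.trans_le h.1, h.2⟩, h.1⟩⟩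
    calc (∫ x in t..b, r x) * f t = ∫ x in Ioc a b ∩ Ici t, r x * f t := by
          rw [integral_of_le ht.2, hset, integral_Icc_eq_integral_Ioc,
            MeasureTheory.integral_mul_const]
      _ = _ := by
          rw [← setIntegral_indicator measurableSet_Ici]
          rfl

/-- The weighted Cauchy-Schwarz inequality on an interval. -/
theorem sq_integral_mul_le_integral_sq_div_mul_integral_mul_sq {a b : ℝ} (hab : a ≤ b)
    {g f s : ℝ → ℝ} (hs : ∀ x ∈ Ioo a b, 0 < s x)
    (hgf : IntervalIntegrable (fun x => g x * f x) volume a b)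
    (hg : IntervalIntegrable (fun x => g x ^ 2 / s x) volume a b)
    (hf : IntervalIntegrable (fun x => s x * f x ^ 2) volume a b) :
    (∫ x in a..b, g x * f x) ^ 2 ≤
      (∫ x in a..b, g x ^ 2 / s x) * (∫ x in a..b, s x * f x ^ 2) := by
  have key (c : ℝ) : 0 ≤ (∫ x in a..b, s x * f x ^ 2) * (c * c) +
      (2 * ∫ x in a..b, g x * f x) * c + ∫ x in a..b, g x ^ 2 / s x := by
    have hmono := integral_mono_on_of_le_Ioo hab (hgf.const_mul (-(2 * c)))
      (hg.add (hf.const_mul (c ^ 2))) fun x hx => by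
        have hsx := hs x hx
        have hsq : g x ^ 2 / s x + c ^ 2 * (s x * f x ^ 2) - -(2 * c) * (g x * f x) =
            (g x + c * (s x * f x)) ^ 2 / s x := by
          field_simp
          ring
        exact sub_nonneg.1 (hsq ▸ by positivity)
    rw [intervalIntegral.integral_add hg (hf.const_mul _), intervalIntegral.integral_const_mul,
      intervalIntegral.integral_const_mul] at hmono
    linarith
  have hdiscrim := discrim_le_zero key
  rw [discrim] at hdiscrim
  linarith

/-- Theorem 2.1: For positive continuous `r, s` on `(a,b)` and nonnegative
measurable `f` (all integrals existing and finite),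
`(∫_a^b r(x)(∫_a^x f) dx)² ≤ (∫_a^b R(x,b)²/s(x) dx) · (∫_a^b s(x) f(x)² dx)`,
where `R(x,b) = ∫_x^b r(t) dt`. -/
theorem hardy_type_thm_2_1 (a b : ℝ) (hab : a < b) (r s f : ℝ → ℝ)
    (hr : ContinuousOn r (Ioo a b)) (hrpos : ∀ x ∈ Ioo a b, 0 < r x)
    (hs : ContinuousOn s (Ioo a b)) (hspos : ∀ x ∈ Ioo a b, 0 < s x)
    (hfmeas : Measurable f) (hfnonneg : ∀ x ∈ Ioo a b, 0 ≤ f x)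
    (hfi : IntervalIntegrable f volume a b)
    (hri : IntervalIntegrable r volume a b)
    (h1 : IntervalIntegrable (fun x => r x * ∫ t in a..x, f t) volume a b)
    (h2 : IntervalIntegrable (fun x => (∫ t in x..b, r t) ^ 2 / s x) volume a b)
    (h3 : IntervalIntegrable (fun x => s x * f x ^ 2) volume a b) :
    (∫ x in a..b, r x * ∫ t in a..x, f t) ^ 2 ≤
      (∫ x in a..b, (∫ t in x..b, r t) ^ 2 / s x) * (∫ x in a..b, s x * f x ^ 2) := by
  have hR : ContinuousOn (fun x => ∫ t in x..b, r t) (uIcc a b) :=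
    continuousOn_primitive_interval_left
      ((intervalIntegrable_iff' (by simp)).1 hri)
  rw [integral_mul_primitive_eq_integral_mul_tail hab.le hri hfi]
  exact sq_integral_mul_le_integral_sq_div_mul_integral_mul_sq hab.le hspos
    (hfi.continuousOn_mul hR) h2 h3
end

section
/- Let a < b be real numbers and let r and s be positive continuous functions on the interval (a,b). Then for every nonnegative measurable function f on (a,b) for which all the integrals below exist and are finite, (∫_a^b r(x)(∫_x^b f(t) dt) dx)² ≤ (∫_a^b R(a,x)²/s(x) dx) · (∫_a^b s(x) f(x)² dx). -/
open MeasureTheory intervalIntegral Set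

/-- The product `r x * f t`, restricted to the triangle `x < t`, is integrable on the square. -/
theorem integrable_indicator_lt_mul_prod {a b : ℝ} {r f : ℝ → ℝ}
    (hr : IntegrableOn r (Ioo a b)) (hf : IntegrableOn f (Ioo a b)) :
    Integrable ({p : ℝ × ℝ | p.1 < p.2}.indicator fun p => r p.1 * f p.2)
      ((volume.restrict (Ioo a b)).prod (volume.restrict (Ioo a b))) :=
  (Integrable.mul_prod hr hf).indicator (measurableSet_lt measurable_fst measurable_snd)

theorem setIntegral_indicator_lt_mul_left {a b t : ℝ} (r f : ℝ → ℝ) (ht : t ∈ Ioo a b) :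
    (∫ x in Ioo a b, {p : ℝ × ℝ | p.1 < p.2}.indicator (fun p => r p.1 * f p.2) (x, t)) =
      (∫ x in a..t, r x) * f t := by
  have h : (fun x => {p : ℝ × ℝ | p.1 < p.2}.indicator (fun p => r p.1 * f p.2) (x, t)) =
      (Iio t).indicator fun x => r x * f t := by
    ext x
    simp [indicator_apply]
  rw [h, setIntegral_indicator measurableSet_Iio, Ioo_inter_Iio, min_eq_right ht.2.le,
    MeasureTheory.integral_mul_const, intervalIntegral.integral_of_le ht.1.le,
    integral_Ioc_eq_integral_Ioo]

theorem setIntegral_indicator_lt_mul_right {a b x : ℝ} (r f : ℝ → ℝ) (hx : x ∈ Ioo a b) :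
    (∫ t in Ioo a b, {p : ℝ × ℝ | p.1 < p.2}.indicator (fun p => r p.1 * f p.2) (x, t)) =
      r x * ∫ t in x..b, f t := by
  have h : (fun t => {p : ℝ × ℝ | p.1 < p.2}.indicator (fun p => r p.1 * f p.2) (x, t)) =
      (Ioi x).indicator fun t => r x * f t := by
    ext t
    simp [indicator_apply]
  rw [h, setIntegral_indicator measurableSet_Ioi, Ioo_inter_Ioi, max_eq_right hx.1.le,
    MeasureTheory.integral_const_mul, intervalIntegral.integral_of_le hx.2.le,
    integral_Ioc_eq_integral_Ioo]

theorem integrableOn_integral_mul {a b : ℝ} {r f : ℝ → ℝ}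
    (hr : IntegrableOn r (Ioo a b)) (hf : IntegrableOn f (Ioo a b)) :
    IntegrableOn (fun t => (∫ x in a..t, r x) * f t) (Ioo a b) :=
  (integrable_indicator_lt_mul_prod hr hf).integral_prod_right.congr <|
    (ae_restrict_mem measurableSet_Ioo).mono fun _ => setIntegral_indicator_lt_mul_left r f

/-- Interchange of the order of integration over the triangle `a < x < t < b`. -/
theorem setIntegral_mul_integral_eq {a b : ℝ} {r f : ℝ → ℝ}
    (hr : IntegrableOn r (Ioo a b)) (hf : IntegrableOn f (Ioo a b)) :
    (∫ x in Ioo a b, r x * ∫ t in x..b, f t) =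
      ∫ t in Ioo a b, (∫ x in a..t, r x) * f t := by
  rw [← setIntegral_congr_fun measurableSet_Ioo fun _ => setIntegral_indicator_lt_mul_left r f,
    ← setIntegral_congr_fun measurableSet_Ioo fun _ => setIntegral_indicator_lt_mul_right r f]
  exact integral_integral_swap (integrable_indicator_lt_mul_prod hr hf)

/-- A weighted Cauchy–Schwarz inequality on a set. -/
theorem sq_setIntegral_mul_le {α : Type*} [MeasurableSpace α] {μ : Measure α} {S : Set α}
    (hS : MeasurableSet S) {g f s : α → ℝ} (hs : ∀ x ∈ S, 0 < s x)
    (hgf : IntegrableOn (fun x => g x * f x) S μ)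
    (hg : IntegrableOn (fun x => g x ^ 2 / s x) S μ)
    (hf : IntegrableOn (fun x => s x * f x ^ 2) S μ) :
    (∫ x in S, g x * f x ∂μ) ^ 2 ≤
      (∫ x in S, g x ^ 2 / s x ∂μ) * ∫ x in S, s x * f x ^ 2 ∂μ := by
  have key (c : ℝ) : 0 ≤ (∫ x in S, g x ^ 2 / s x ∂μ) * (c * c) +
      (2 * ∫ x in S, g x * f x ∂μ) * c + ∫ x in S, s x * f x ^ 2 ∂μ := by
    have hadd : IntegrableOn (fun x => g x ^ 2 / s x * (c * c) + g x * f x * (2 * c)) S μ :=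
      (hg.mul_const _).add (hgf.mul_const _)
    have h : 0 ≤ ∫ x in S, (g x ^ 2 / s x * (c * c) + g x * f x * (2 * c) + s x * f x ^ 2) ∂μ := by
      refine setIntegral_nonneg hS fun x hx => ?_
      have hsx := hs x hx
      have : g x ^ 2 / s x * (c * c) + g x * f x * (2 * c) + s x * f x ^ 2 =
          (c * g x + s x * f x) ^ 2 / s x := by
        field_simp
        ring
      rw [this]
      positivity
    rw [integral_add hadd hf,
      integral_add (hg.mul_const _) (hgf.mul_const _),
      MeasureTheory.integral_mul_const, MeasureTheory.integral_mul_const] at h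
    linarith
  have := discrim_le_zero key
  rw [discrim] at this
  linarith

/-- Theorem 2.2: For positive continuous `r, s` on `(a,b)` and nonnegative
measurable `f` (all integrals existing and finite),
`(∫_a^b r(x)(∫_x^b f) dx)² ≤ (∫_a^b R(a,x)²/s(x) dx) · (∫_a^b s(x) f(x)² dx)`,
where `R(a,x) = ∫_a^x r(t) dt`. -/
theorem hardy_type_thm_2_2 (a b : ℝ) (hab : a < b) (r s f : ℝ → ℝ)
    (hr : ContinuousOn r (Ioo a b)) (hrpos : ∀ x ∈ Ioo a b, 0 < r x)
    (hs : ContinuousOn s (Ioo a b)) (hspos : ∀ x ∈ Ioo a b, 0 < s x)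
    (hfmeas : Measurable f) (hfnonneg : ∀ x ∈ Ioo a b, 0 ≤ f x)
    (hfi : IntervalIntegrable f volume a b)
    (hri : IntervalIntegrable r volume a b)
    (h1 : IntervalIntegrable (fun x => r x * ∫ t in x..b, f t) volume a b)
    (h2 : IntervalIntegrable (fun x => (∫ t in a..x, r t) ^ 2 / s x) volume a b)
    (h3 : IntervalIntegrable (fun x => s x * f x ^ 2) volume a b) :
    (∫ x in a..b, r x * ∫ t in x..b, f t) ^ 2 ≤
      (∫ x in a..b, (∫ t in a..x, r t) ^ 2 / s x) * (∫ x in a..b, s x * f x ^ 2) := by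
  rw [intervalIntegrable_iff_integrableOn_Ioo_of_le hab.le] at hfi hri h2 h3
  simp only [intervalIntegral.integral_of_le hab.le, integral_Ioc_eq_integral_Ioo]
  rw [setIntegral_mul_integral_eq hri hfi]
  exact sq_setIntegral_mul_le measurableSet_Ioo hspos (integrableOn_integral_mul hri hfi) h2 h3
end

section
/- Let a < b be real numbers and let r be a positive continuous function on the interval (a,b). Then for every nonnegative measurable function f on (a,b) for which all the integrals below exist and are finite, ∫_a^b r(x)(∫_a^x f(t) dt)² dx ≤ (b−a) · sup_{a<x<b} (∫_x^b r(t) dt) · ∫_a^b f(x)² dx. -/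
open MeasureTheory intervalIntegral Set

/-- Cauchy–Schwarz against the constant function `1` on an interval. -/
theorem sq_intervalIntegral_le {f : ℝ → ℝ} {a x : ℝ} (hax : a < x)
    (hf : IntervalIntegrable f volume a x)
    (hf2 : IntervalIntegrable (fun t => f t ^ 2) volume a x) :
    (∫ t in a..x, f t) ^ 2 ≤ (x - a) * ∫ t in a..x, f t ^ 2 := by
  set I := ∫ t in a..x, f t with hI
  set L := x - a with hL
  have hLpos : 0 < L := sub_pos.2 hax
  have hnonneg : 0 ≤ ∫ t in a..x, (L * f t - I) ^ 2 :=
    intervalIntegral.integral_nonneg hax.le fun t _ => sq_nonneg _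
  have hexpand : ∫ t in a..x, (L * f t - I) ^ 2 =
      L ^ 2 * (∫ t in a..x, f t ^ 2) - 2 * L * I * I + L * I ^ 2 := by
    calc ∫ t in a..x, (L * f t - I) ^ 2
        = ∫ t in a..x, (L ^ 2 * f t ^ 2 - 2 * L * I * f t + I ^ 2) := by
          congr 1; ext t; ring
      _ = _ := by
          rw [intervalIntegral.integral_add ((hf2.const_mul _).sub (hf.const_mul _))
              intervalIntegrable_const,
            intervalIntegral.integral_sub (hf2.const_mul _) (hf.const_mul _),
            intervalIntegral.integral_const_mul, intervalIntegral.integral_const_mul,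
            intervalIntegral.integral_const, smul_eq_mul]
  rw [hexpand] at hnonneg
  refine le_of_mul_le_mul_left ?_ hLpos
  linarith

/-- The full integral is at most the supremum of the tail integrals. -/
theorem intervalIntegral_le_sSup_tail {r : ℝ → ℝ} {a b : ℝ} (hab : a < b)
    (hri : IntervalIntegrable r volume a b) :
    ∫ t in a..b, r t ≤ sSup ((fun x => ∫ t in x..b, r t) '' Ioo a b) := by
  have hcont : ContinuousOn (fun x => ∫ t in x..b, r t) (Icc a b) := by
    have h := (intervalIntegral.continuousOn_primitive_interval'
      hri.symm left_mem_uIcc).neg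
    rw [uIcc_comm, uIcc_of_le hab.le] at h
    exact h.congr fun x _ => intervalIntegral.integral_symm b x
  have hbdd : BddAbove ((fun x => ∫ t in x..b, r t) '' Ioo a b) :=
    (isCompact_Icc.bddAbove_image hcont).mono (image_mono Ioo_subset_Icc_self)
  have htend := (hcont a (left_mem_Icc.2 hab.le)).mono Ioo_subset_Icc_self
  have : (nhdsWithin a (Ioo a b)).NeBot := left_nhdsWithin_Ioo_neBot hab
  exact le_of_tendsto htend <| by
    filter_upwards [self_mem_nhdsWithin] with x hx
    exact le_csSup hbdd (mem_image_of_mem _ hx)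

/-- Theorem 2.3: For positive continuous `r` on `(a,b)` and nonnegative measurable `f`
(all integrals existing and finite),
`∫_a^b r(x)(∫_a^x f)² dx ≤ (b−a) · sup_{a<x<b} (∫_x^b r) · ∫_a^b f²`. -/
theorem hardy_type_thm_2_3 (a b : ℝ) (hab : a < b) (r f : ℝ → ℝ)
    (hr : ContinuousOn r (Ioo a b)) (hrpos : ∀ x ∈ Ioo a b, 0 < r x)
    (hfmeas : Measurable f) (hfnonneg : ∀ x ∈ Ioo a b, 0 ≤ f x)
    (hfi : IntervalIntegrable f volume a b)
    (hri : IntervalIntegrable r volume a b)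
    (h1 : IntervalIntegrable (fun x => r x * (∫ t in a..x, f t) ^ 2) volume a b)
    (h2 : IntervalIntegrable (fun x => f x ^ 2) volume a b) :
    ∫ x in a..b, r x * (∫ t in a..x, f t) ^ 2 ≤
      (b - a) * sSup ((fun x => ∫ t in x..b, r t) '' Ioo a b) * ∫ x in a..b, f x ^ 2 := by
  set F := ∫ x in a..b, f x ^ 2 with hF
  have hF0 : 0 ≤ F := intervalIntegral.integral_nonneg hab.le fun t _ => sq_nonneg _
  have hba : 0 ≤ b - a := sub_nonneg.2 hab.le
  have hbound : ∀ x ∈ Ioo a b, (∫ t in a..x, f t) ^ 2 ≤ (b - a) * F := by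
    intro x hx
    have hsub : uIcc a x ⊆ uIcc a b := by
      rw [uIcc_of_le hx.1.le, uIcc_of_le hab.le]
      exact Icc_subset_Icc_right hx.2.le
    refine (sq_intervalIntegral_le hx.1 (hfi.mono_set hsub) (h2.mono_set hsub)).trans ?_
    have hmono : ∫ t in a..x, f t ^ 2 ≤ F :=
      intervalIntegral.integral_mono_interval le_rfl hx.1.le hx.2.le
        (Filter.Eventually.of_forall fun t => sq_nonneg _) h2
    exact mul_le_mul (by linarith [hx.2]) hmono
      (intervalIntegral.integral_nonneg hx.1.le fun t _ => sq_nonneg _) hba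
  calc ∫ x in a..b, r x * (∫ t in a..x, f t) ^ 2
      ≤ ∫ x in a..b, r x * ((b - a) * F) :=
        intervalIntegral.integral_mono_on_of_le_Ioo hab.le h1 (hri.mul_const _) fun x hx =>
          mul_le_mul_of_nonneg_left (hbound x hx) (hrpos x hx).le
    _ = (b - a) * (∫ x in a..b, r x) * F := by
        rw [intervalIntegral.integral_mul_const]; ring
    _ ≤ _ := by
        gcongr
        exact intervalIntegral_le_sSup_tail hab hri
end

section
/- Let a < b be real numbers and let r be a positive continuous function on the interval (a,b). Then for every nonnegative measurable function f on (a,b) for which all the integrals below exist and are finite, ∫_a^b r(x)(∫_x^b f(t) dt)² dx ≤ (b−a) · sup_{a<x<b} (∫_a^x r(t) dt) · ∫_a^b f(x)² dx. -/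
open MeasureTheory intervalIntegral Set

/-- Cauchy–Schwarz for the integral of a function over a bounded interval. -/
lemma sq_integral_le_sub_mul_integral_sq {f : ℝ → ℝ} {c d : ℝ} (hcd : c < d)
    (hf : IntervalIntegrable f volume c d)
    (hf2 : IntervalIntegrable (fun x => f x ^ 2) volume c d) :
    (∫ t in c..d, f t) ^ 2 ≤ (d - c) * ∫ t in c..d, f t ^ 2 := by
  set I := ∫ t in c..d, f t with hI
  set J := ∫ t in c..d, f t ^ 2 with hJ
  have hpos : 0 < d - c := sub_pos.2 hcd
  have hquad (k : ℝ) : 0 ≤ J - 2 * k * I + k ^ 2 * (d - c) := by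
    have h : ∫ t in c..d, (f t - k) ^ 2 = J - 2 * k * I + k ^ 2 * (d - c) := by
      have hexp : (fun t => (f t - k) ^ 2) = fun t => f t ^ 2 - 2 * k * f t + k ^ 2 := by
        ext t; ring
      rw [hexp, integral_add (hf2.sub (hf.const_mul _)) intervalIntegrable_const,
        integral_sub hf2 (hf.const_mul _), intervalIntegral.integral_const_mul,
        intervalIntegral.integral_const, smul_eq_mul, mul_comm (d - c)]
    rw [← h]
    exact integral_nonneg hcd.le fun t _ => sq_nonneg _
  have h := mul_nonneg hpos.le (hquad (I / (d - c)))
  have hsimp : (d - c) * (J - 2 * (I / (d - c)) * I + (I / (d - c)) ^ 2 * (d - c)) =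
      (d - c) * J - I ^ 2 := by
    field_simp
    ring
  linarith

/-- The full integral of an integrable function is at most the supremum of its primitive
over `(a, b)`. -/
lemma integral_le_sSup_primitive {r : ℝ → ℝ} {a b : ℝ} (hab : a < b)
    (hri : IntervalIntegrable r volume a b) :
    ∫ t in a..b, r t ≤ sSup ((fun x => ∫ t in a..x, r t) '' Ioo a b) := by
  have hcont : ContinuousOn (fun x => ∫ t in a..x, r t) (Icc a b) := by
    have h := continuousOn_primitive_interval (μ := volume) (f := r) (a := a) (b := b)
      (by rwa [uIcc_of_le hab.le, ← intervalIntegrable_iff_integrableOn_Icc_of_le hab.le])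
    rwa [uIcc_of_le hab.le] at h
  have hbdd : BddAbove ((fun x => ∫ t in a..x, r t) '' Ioo a b) :=
    (isCompact_Icc.bddAbove_image hcont).mono (image_mono Ioo_subset_Icc_self)
  have hmem : b ∈ closure (Ioo a b) := by
    rw [closure_Ioo hab.ne]
    exact right_mem_Icc.2 hab.le
  have : (nhdsWithin b (Ioo a b)).NeBot := mem_closure_iff_nhdsWithin_neBot.1 hmem
  refine le_of_tendsto ((hcont b (right_mem_Icc.2 hab.le)).mono Ioo_subset_Icc_self) ?_
  filter_upwards [self_mem_nhdsWithin] with x hx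
  exact le_csSup hbdd (mem_image_of_mem _ hx)

/-- Theorem 2.4: For positive continuous `r` on `(a,b)` and nonnegative measurable `f`
(all integrals existing and finite),
`∫_a^b r(x)(∫_x^b f)² dx ≤ (b−a) · sup_{a<x<b} (∫_a^x r) · ∫_a^b f²`. -/
theorem hardy_type_thm_2_4 (a b : ℝ) (hab : a < b) (r f : ℝ → ℝ)
    (hr : ContinuousOn r (Ioo a b)) (hrpos : ∀ x ∈ Ioo a b, 0 < r x)
    (hfmeas : Measurable f) (hfnonneg : ∀ x ∈ Ioo a b, 0 ≤ f x)
    (hfi : IntervalIntegrable f volume a b)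
    (hri : IntervalIntegrable r volume a b)
    (h1 : IntervalIntegrable (fun x => r x * (∫ t in x..b, f t) ^ 2) volume a b)
    (h2 : IntervalIntegrable (fun x => f x ^ 2) volume a b) :
    ∫ x in a..b, r x * (∫ t in x..b, f t) ^ 2 ≤
      (b - a) * sSup ((fun x => ∫ t in a..x, r t) '' Ioo a b) * ∫ x in a..b, f x ^ 2 := by
  set F := ∫ x in a..b, f x ^ 2 with hF
  have hF0 : 0 ≤ F := integral_nonneg hab.le fun t _ => sq_nonneg _
  have hba : 0 ≤ b - a := (sub_pos.2 hab).le
  have hinner : ∀ x ∈ Ioo a b, (∫ t in x..b, f t) ^ 2 ≤ (b - a) * F := by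
    intro x hx
    have hsub : uIcc x b ⊆ uIcc a b := by
      rw [uIcc_of_le hx.2.le, uIcc_of_le hab.le]
      exact Icc_subset_Icc_left hx.1.le
    refine (sq_integral_le_sub_mul_integral_sq hx.2 (hfi.mono_set hsub)
      (h2.mono_set hsub)).trans ?_
    refine mul_le_mul (by linarith [hx.1]) ?_
      (integral_nonneg hx.2.le fun t _ => sq_nonneg _) hba
    exact integral_mono_interval hx.1.le hx.2.le le_rfl
      (Filter.Eventually.of_forall fun t => sq_nonneg (f t)) h2
  calc ∫ x in a..b, r x * (∫ t in x..b, f t) ^ 2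
      ≤ ∫ x in a..b, r x * ((b - a) * F) :=
        integral_mono_on_of_le_Ioo hab.le h1 (hri.mul_const _) fun x hx =>
          mul_le_mul_of_nonneg_left (hinner x hx) (hrpos x hx).le
    _ = (b - a) * (∫ x in a..b, r x) * F := by
        rw [intervalIntegral.integral_mul_const]
        ring
    _ ≤ (b - a) * sSup ((fun x => ∫ t in a..x, r t) '' Ioo a b) * F := by
        gcongr
        exact integral_le_sSup_primitive hab hri
end

section
/- Let a < b be real numbers, let r and s be positive continuous functions on the interval (a,b), and let p > 1 and q > 1 satisfy 1/p + 1/q = 1, with ∫_a^b (1/s(x))^{p−1} dx < ∞. Then for every nonnegative measurable function f on (a,b) for which all the integrals below exist and are finite, ∫_a^b r(x)(∫_a^x f(t) dt)² dx ≤ sup_{a<x<b} R(x,b) · (∫_a^b (1/s(x))^{p−1} dx)^{2/p} · (∫_a^b s(x) f(x)^q dx)^{2/q}. -/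
open MeasureTheory intervalIntegral Set

/-- Hölder's inequality for the factorization `f = s ^ (-1 / q) * (s ^ (1 / q) * f)`. -/
theorem integral_le_weighted_Lp_mul_Lq {α : Type*} [MeasurableSpace α] {μ : Measure α}
    {p q : ℝ} (hpq : p.HolderConjugate q) {s f : α → ℝ}
    (hs : AEStronglyMeasurable s μ) (hspos : ∀ᵐ x ∂μ, 0 < s x)
    (hf : AEStronglyMeasurable f μ) (hfnonneg : ∀ᵐ x ∂μ, 0 ≤ f x)
    (hsint : Integrable (fun x => (1 / s x) ^ (p - 1)) μ)
    (hsf : Integrable (fun x => s x * f x ^ q) μ) :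
    ∫ x, f x ∂μ ≤
      (∫ x, (1 / s x) ^ (p - 1) ∂μ) ^ (1 / p) * (∫ x, s x * f x ^ q ∂μ) ^ (1 / q) := by
  have hp0 := hpq.pos
  have hq0 := hpq.symm.pos
  have hexp : 1 / q * p = p - 1 := by
    rw [one_div, ← hpq.one_sub_inv]
    field_simp
  have hu : ∀ᵐ x ∂μ, 0 ≤ (1 / s x) ^ (1 / q) := by
    filter_upwards [hspos] with x hx
    positivity
  have hv : ∀ᵐ x ∂μ, 0 ≤ s x ^ (1 / q) * f x := by
    filter_upwards [hspos, hfnonneg] with x hx hfx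
    positivity
  have hup : (fun x => ((1 / s x) ^ (1 / q)) ^ p) =ᵐ[μ] fun x => (1 / s x) ^ (p - 1) := by
    filter_upwards [hspos] with x hx
    rw [← Real.rpow_mul (by positivity), hexp]
  have hvq : (fun x => (s x ^ (1 / q) * f x) ^ q) =ᵐ[μ] fun x => s x * f x ^ q := by
    filter_upwards [hspos, hfnonneg] with x hx hfx
    rw [Real.mul_rpow (by positivity) hfx, ← Real.rpow_mul hx.le,
      one_div_mul_cancel hq0.ne', Real.rpow_one]
  have huv : (fun x => (1 / s x) ^ (1 / q) * (s x ^ (1 / q) * f x)) =ᵐ[μ] f := by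
    filter_upwards [hspos] with x hx
    rw [← mul_assoc, ← Real.mul_rpow (by positivity) hx.le, one_div_mul_cancel hx.ne',
      Real.one_rpow, one_mul]
  have hu_meas : AEStronglyMeasurable (fun x => (1 / s x) ^ (1 / q)) μ :=
    ((hs.aemeasurable.const_div 1).pow_const _).aestronglyMeasurable
  have hv_meas : AEStronglyMeasurable (fun x => s x ^ (1 / q) * f x) μ :=
    ((hs.aemeasurable.pow_const _).mul hf.aemeasurable).aestronglyMeasurable
  have hu_mem : MemLp (fun x => (1 / s x) ^ (1 / q)) (ENNReal.ofReal p) μ := by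
    rw [← integrable_norm_rpow_iff hu_meas (by simpa using hp0) ENNReal.ofReal_ne_top,
      ENNReal.toReal_ofReal hp0.le]
    refine hsint.congr ?_
    filter_upwards [hup, hu] with x hx hux
    rw [Real.norm_of_nonneg hux, hx]
  have hv_mem : MemLp (fun x => s x ^ (1 / q) * f x) (ENNReal.ofReal q) μ := by
    rw [← integrable_norm_rpow_iff hv_meas (by simpa using hq0) ENNReal.ofReal_ne_top,
      ENNReal.toReal_ofReal hq0.le]
    refine hsf.congr ?_
    filter_upwards [hvq, hv] with x hx hvx
    rw [Real.norm_of_nonneg hvx, hx]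
  have key := integral_mul_le_Lp_mul_Lq_of_nonneg hpq hu hv hu_mem hv_mem
  rwa [integral_congr_ae hup, integral_congr_ae hvq, integral_congr_ae huv] at key

/-- The full integral of an integrable function is at most the supremum of its tail integrals. -/
theorem integral_le_sSup_tail_integral {a b : ℝ} (hab : a < b) {r : ℝ → ℝ}
    (hri : IntervalIntegrable r volume a b) :
    ∫ x in a..b, r x ≤ sSup ((fun x => ∫ t in x..b, r t) '' Ioo a b) := by
  have hcont : ContinuousOn (fun x => ∫ t in x..b, r t) (Icc a b) := by
    rw [← uIcc_of_le hab.le]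
    exact (continuousOn_primitive_interval' hri right_mem_uIcc).neg.congr
      fun x _ => integral_symm _ _
  have hbdd : BddAbove ((fun x => ∫ t in x..b, r t) '' Ioo a b) :=
    (isCompact_Icc.bddAbove_image hcont).mono (image_mono Ioo_subset_Icc_self)
  have htend := (hcont a (left_mem_Icc.2 hab.le)).mono Ioo_subset_Icc_self
  have : (nhdsWithin a (Ioo a b)).NeBot := by
    rw [nhdsWithin_Ioo_eq_nhdsGT hab]
    infer_instance
  refine le_of_tendsto htend ?_
  filter_upwards [self_mem_nhdsWithin] with x hx
  exact le_csSup hbdd (mem_image_of_mem _ hx)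

/-- Theorem 2.7: For positive continuous `r, s` on `(a,b)`, conjugate exponents
`p, q > 1` with `∫_a^b (1/s(x))^(p−1) dx < ∞`, and nonnegative measurable `f`
(all integrals existing and finite),
`∫_a^b r(x)(∫_a^x f)² dx ≤ sup_{a<x<b} R(x,b) · (∫_a^b (1/s)^(p−1))^(2/p) ·
(∫_a^b s f^q)^(2/q)`, where `R(x,b) = ∫_x^b r(t) dt`. -/
theorem hardy_type_thm_2_7 (a b : ℝ) (hab : a < b) (p q : ℝ) (hp : 1 < p) (hq : 1 < q)
    (hpq : 1 / p + 1 / q = 1) (r s f : ℝ → ℝ)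
    (hr : ContinuousOn r (Ioo a b)) (hrpos : ∀ x ∈ Ioo a b, 0 < r x)
    (hs : ContinuousOn s (Ioo a b)) (hspos : ∀ x ∈ Ioo a b, 0 < s x)
    (hsint : IntervalIntegrable (fun x => (1 / s x) ^ (p - 1)) volume a b)
    (hfmeas : Measurable f) (hfnonneg : ∀ x ∈ Ioo a b, 0 ≤ f x)
    (hfi : IntervalIntegrable f volume a b)
    (hri : IntervalIntegrable r volume a b)
    (h1 : IntervalIntegrable (fun x => r x * (∫ t in a..x, f t) ^ 2) volume a b)
    (h2 : IntervalIntegrable (fun x => s x * f x ^ q) volume a b) :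
    ∫ x in a..b, r x * (∫ t in a..x, f t) ^ 2 ≤
      sSup ((fun x => ∫ t in x..b, r t) '' Ioo a b) *
        (∫ x in a..b, (1 / s x) ^ (p - 1)) ^ (2 / p) *
        (∫ x in a..b, s x * f x ^ q) ^ (2 / q) := by
  have hconj : p.HolderConjugate q :=
    Real.holderConjugate_iff.2 ⟨hp, by simpa only [one_div] using hpq⟩
  have hmem : ∀ᵐ x ∂volume.restrict (Ioo a b), x ∈ Ioo a b := ae_restrict_mem measurableSet_Ioo
  have hA : 0 ≤ ∫ x in a..b, (1 / s x) ^ (p - 1) := by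
    rw [integral_of_le hab.le, integral_Ioc_eq_integral_Ioo]
    refine setIntegral_nonneg measurableSet_Ioo fun x hx => ?_
    have := hspos x hx
    positivity
  have hB : 0 ≤ ∫ x in a..b, s x * f x ^ q := by
    rw [integral_of_le hab.le, integral_Ioc_eq_integral_Ioo]
    refine setIntegral_nonneg measurableSet_Ioo fun x hx => ?_
    have := hspos x hx
    have := hfnonneg x hx
    positivity
  have hholder : ∫ x in a..b, f x ≤ (∫ x in a..b, (1 / s x) ^ (p - 1)) ^ (1 / p) *
      (∫ x in a..b, s x * f x ^ q) ^ (1 / q) := by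
    simp only [integral_of_le hab.le, integral_Ioc_eq_integral_Ioo]
    exact integral_le_weighted_Lp_mul_Lq hconj (hs.aestronglyMeasurable measurableSet_Ioo)
      (hmem.mono hspos) hfmeas.aestronglyMeasurable (hmem.mono hfnonneg)
      ((intervalIntegrable_iff_integrableOn_Ioo_of_le hab.le).1 hsint)
      ((intervalIntegrable_iff_integrableOn_Ioo_of_le hab.le).1 h2)
  set A := ∫ x in a..b, (1 / s x) ^ (p - 1)
  set B := ∫ x in a..b, s x * f x ^ q
  have hsq : (A ^ (1 / p) * B ^ (1 / q)) ^ 2 = A ^ (2 / p) * B ^ (2 / q) := by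
    rw [mul_pow, ← Real.rpow_mul_natCast hA, ← Real.rpow_mul_natCast hB]
    push_cast
    rw [one_div_mul_eq_div, one_div_mul_eq_div]
  have hbound : ∀ x ∈ Ioo a b,
      r x * (∫ t in a..x, f t) ^ 2 ≤ r x * (A ^ (2 / p) * B ^ (2 / q)) := by
    intro x hx
    have hF : 0 ≤ ∫ t in a..x, f t := by
      rw [integral_of_le hx.1.le]
      exact setIntegral_nonneg measurableSet_Ioc fun t ht =>
        hfnonneg t ⟨ht.1, ht.2.trans_lt hx.2⟩
    have hFle : ∫ t in a..x, f t ≤ ∫ t in a..b, f t := by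
      simp only [integral_of_le hx.1.le, integral_of_le hab.le, integral_Ioc_eq_integral_Ioo]
      exact setIntegral_mono_set ((intervalIntegrable_iff_integrableOn_Ioo_of_le hab.le).1 hfi)
        (hmem.mono hfnonneg) (Ioo_subset_Ioo_right hx.2.le).eventuallyLE
    rw [← hsq]
    exact mul_le_mul_of_nonneg_left (pow_le_pow_left₀ hF (hFle.trans hholder) 2) (hrpos x hx).le
  calc ∫ x in a..b, r x * (∫ t in a..x, f t) ^ 2
      ≤ ∫ x in a..b, r x * (A ^ (2 / p) * B ^ (2 / q)) :=
        integral_mono_on_of_le_Ioo hab.le h1 (hri.mul_const _) hbound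
    _ = (∫ x in a..b, r x) * (A ^ (2 / p) * B ^ (2 / q)) := integral_mul_const _ _
    _ ≤ sSup ((fun x => ∫ t in x..b, r t) '' Ioo a b) * (A ^ (2 / p) * B ^ (2 / q)) :=
        mul_le_mul_of_nonneg_right
          (integral_le_sSup_tail_integral hab hri) (by positivity)
    _ = _ := (mul_assoc _ _ _).symm
end

section
/- Let a < b be real numbers, let r and s be positive continuous functions on the interval (a,b), and let p > 1 and q > 1 satisfy 1/p + 1/q = 1, with ∫_a^b (1/s(x))^{p−1} dx < ∞. Then for every nonnegative measurable function f on (a,b) for which all the integrals below exist and are finite, ∫_a^b r(x)(∫_x^b f(t) dt)² dx ≤ sup_{a<x<b} R(a,x) · (∫_a^b (1/s(x))^{p−1} dx)^{2/p} · (∫_a^b s(x) f(x)^q dx)^{2/q}. -/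
open MeasureTheory intervalIntegral Set

/-- Hölder's inequality for `f = s ^ (-1 / q) * (s ^ (1 / q) * f)` with a positive weight `s`. -/
theorem integral_le_rpow_mul_rpow_of_weight {α : Type*} {_ : MeasurableSpace α} {μ : Measure α}
    {p q : ℝ} (hpq : p.HolderConjugate q) {s f : α → ℝ} (hs : AEMeasurable s μ)
    (hf : AEMeasurable f μ) (hspos : ∀ᵐ x ∂μ, 0 < s x) (hf0 : ∀ᵐ x ∂μ, 0 ≤ f x)
    (hsint : Integrable (fun x => (1 / s x) ^ (p - 1)) μ)
    (hfint : Integrable (fun x => s x * f x ^ q) μ) :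
    ∫ x, f x ∂μ ≤
      (∫ x, (1 / s x) ^ (p - 1) ∂μ) ^ (1 / p) * (∫ x, s x * f x ^ q ∂μ) ^ (1 / q) := by
  have hp0 : 0 < p := hpq.pos
  have hq0 : 0 < q := hpq.symm.pos
  have hexp : 1 / q * p = p - 1 := by
    have := hpq.sub_one_mul_conj
    field_simp
    linarith
  set g : α → ℝ := fun x => (1 / s x) ^ (1 / q) with hg
  set h : α → ℝ := fun x => s x ^ (1 / q) * f x with hh
  have hgm : AEMeasurable g μ := (hs.const_div 1).pow_const _
  have hhm : AEMeasurable h μ := (hs.pow_const _).mul hf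
  have hg0 : 0 ≤ᵐ[μ] g := by
    filter_upwards [hspos] with x hx
    simp only [hg, Pi.zero_apply]
    positivity
  have hh0 : 0 ≤ᵐ[μ] h := by
    filter_upwards [hspos, hf0] with x hx hfx
    simp only [hh, Pi.zero_apply]
    positivity
  have hgp : (fun x => g x ^ p) =ᵐ[μ] fun x => (1 / s x) ^ (p - 1) := by
    filter_upwards [hspos] with x hx
    simp only [hg]
    rw [← Real.rpow_mul (by positivity), hexp]
  have hhq : (fun x => h x ^ q) =ᵐ[μ] fun x => s x * f x ^ q := by
    filter_upwards [hspos, hf0] with x hx hfx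
    simp only [hh]
    rw [Real.mul_rpow (by positivity) hfx, ← Real.rpow_mul hx.le, one_div_mul_cancel hq0.ne',
      Real.rpow_one]
  have hfgh : f =ᵐ[μ] fun x => g x * h x := by
    filter_upwards [hspos] with x hx
    simp only [hg, hh]
    rw [← mul_assoc, ← Real.mul_rpow (by positivity) hx.le, one_div_mul_cancel hx.ne',
      Real.one_rpow, one_mul]
  have memLp {u : α → ℝ} {r : ℝ} (hr : 0 < r) (hu : AEMeasurable u μ) (hu0 : 0 ≤ᵐ[μ] u)
      (hint : Integrable (fun x => u x ^ r) μ) : MemLp u (ENNReal.ofReal r) μ := by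
    rw [← integrable_norm_rpow_iff hu.aestronglyMeasurable (by simpa using hr) (by simp),
      ENNReal.toReal_ofReal hr.le]
    refine hint.congr ?_
    filter_upwards [hu0] with x hx
    rw [Real.norm_of_nonneg hx]
  rw [integral_congr_ae hfgh, ← integral_congr_ae hgp, ← integral_congr_ae hhq]
  exact integral_mul_le_Lp_mul_Lq_of_nonneg hpq hg0 hh0
    (memLp hp0 hgm hg0 (hsint.congr hgp.symm)) (memLp hq0 hhm hh0 (hfint.congr hhq.symm))

/-- The full integral of a nonnegative function is at most the supremum of its primitive over the
open interval. -/
theorem integral_le_sSup_image_primitive {a b : ℝ} (hab : a < b) {r : ℝ → ℝ}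
    (hr0 : ∀ x ∈ Ioo a b, 0 ≤ r x) (hri : IntervalIntegrable r volume a b) :
    ∫ t in a..b, r t ≤ sSup ((fun x => ∫ t in a..x, r t) '' Ioo a b) := by
  have hae : 0 ≤ᵐ[volume.restrict (Ioc a b)] r := by
    rw [← Measure.restrict_congr_set Ioo_ae_eq_Ioc]
    exact ae_restrict_of_forall_mem measurableSet_Ioo hr0
  have hbdd : BddAbove ((fun x => ∫ t in a..x, r t) '' Ioo a b) := by
    refine ⟨∫ t in a..b, r t, ?_⟩
    rintro _ ⟨x, hx, rfl⟩
    exact integral_mono_interval le_rfl hx.1.le hx.2.le hae hri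
  have hcont : ContinuousWithinAt (fun x => ∫ t in a..x, r t) (Ioo a b) b := by
    have := continuousOn_primitive_interval' hri left_mem_uIcc b right_mem_uIcc
    rw [uIcc_of_le hab.le] at this
    exact this.mono Ioo_subset_Icc_self
  have hne : (nhdsWithin b (Ioo a b)).NeBot := right_nhdsWithin_Ioo_neBot hab
  exact le_of_tendsto hcont (eventually_mem_nhdsWithin.mono fun x hx =>
    le_csSup hbdd (mem_image_of_mem _ hx))

/-- Theorem 2.8: For positive continuous `r, s` on `(a,b)`, conjugate exponents
`p, q > 1` with `∫_a^b (1/s(x))^(p−1) dx < ∞`, and nonnegative measurable `f`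
(all integrals existing and finite),
`∫_a^b r(x)(∫_x^b f)² dx ≤ sup_{a<x<b} R(a,x) · (∫_a^b (1/s)^(p−1))^(2/p) ·
(∫_a^b s f^q)^(2/q)`, where `R(a,x) = ∫_a^x r(t) dt`. -/
theorem hardy_type_thm_2_8 (a b : ℝ) (hab : a < b) (p q : ℝ) (hp : 1 < p) (hq : 1 < q)
    (hpq : 1 / p + 1 / q = 1) (r s f : ℝ → ℝ)
    (hr : ContinuousOn r (Ioo a b)) (hrpos : ∀ x ∈ Ioo a b, 0 < r x)
    (hs : ContinuousOn s (Ioo a b)) (hspos : ∀ x ∈ Ioo a b, 0 < s x)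
    (hsint : IntervalIntegrable (fun x => (1 / s x) ^ (p - 1)) volume a b)
    (hfmeas : Measurable f) (hfnonneg : ∀ x ∈ Ioo a b, 0 ≤ f x)
    (hfi : IntervalIntegrable f volume a b)
    (hri : IntervalIntegrable r volume a b)
    (h1 : IntervalIntegrable (fun x => r x * (∫ t in x..b, f t) ^ 2) volume a b)
    (h2 : IntervalIntegrable (fun x => s x * f x ^ q) volume a b) :
    ∫ x in a..b, r x * (∫ t in x..b, f t) ^ 2 ≤
      sSup ((fun x => ∫ t in a..x, r t) '' Ioo a b) *
        (∫ x in a..b, (1 / s x) ^ (p - 1)) ^ (2 / p) *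
        (∫ x in a..b, s x * f x ^ q) ^ (2 / q) := by
  have hpq' : p.HolderConjugate q :=
    Real.holderConjugate_iff.2 ⟨hp, by simpa only [one_div] using hpq⟩
  have hspos' : ∀ᵐ x ∂volume.restrict (Ioo a b), 0 < s x :=
    ae_restrict_of_forall_mem measurableSet_Ioo hspos
  have hf0 : ∀ᵐ x ∂volume.restrict (Ioo a b), 0 ≤ f x :=
    ae_restrict_of_forall_mem measurableSet_Ioo hfnonneg
  have hf0' : 0 ≤ᵐ[volume.restrict (Ioc a b)] f := by
    rwa [← Measure.restrict_congr_set Ioo_ae_eq_Ioc]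
  set A := ∫ x in a..b, (1 / s x) ^ (p - 1) with hA
  set B := ∫ x in a..b, s x * f x ^ q with hB
  have hF : ∫ t in a..b, f t ≤ A ^ (1 / p) * B ^ (1 / q) := by
    rw [hA, hB]
    simp only [integral_of_le hab.le, integral_Ioc_eq_integral_Ioo]
    exact integral_le_rpow_mul_rpow_of_weight hpq' (hs.aemeasurable measurableSet_Ioo)
      hfmeas.aemeasurable hspos' hf0 (hsint.1.mono_set Ioo_subset_Ioc_self)
      (h2.1.mono_set Ioo_subset_Ioc_self)
  have hF0 : 0 ≤ ∫ t in a..b, f t := by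
    rw [integral_of_le hab.le]
    exact integral_nonneg_of_ae hf0'
  have hA0 : 0 ≤ A := by
    rw [hA, integral_of_le hab.le, integral_Ioc_eq_integral_Ioo]
    exact setIntegral_nonneg measurableSet_Ioo fun x hx => by
      have := hspos x hx
      positivity
  have hB0 : 0 ≤ B := by
    rw [hB, integral_of_le hab.le, integral_Ioc_eq_integral_Ioo]
    exact setIntegral_nonneg measurableSet_Ioo fun x hx =>
      mul_nonneg (hspos x hx).le (Real.rpow_nonneg (hfnonneg x hx) _)
  have hsq {C t : ℝ} (hC : 0 ≤ C) : (C ^ (1 / t)) ^ 2 = C ^ (2 / t) := by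
    rw [← Real.rpow_mul_natCast hC]
    congr 1
    push_cast
    ring
  have hF2 : (∫ t in a..b, f t) ^ 2 ≤ A ^ (2 / p) * B ^ (2 / q) := by
    rw [← hsq hA0, ← hsq hB0, ← mul_pow]
    exact pow_le_pow_left₀ hF0 hF 2
  have hR := integral_le_sSup_image_primitive hab (fun x hx => (hrpos x hx).le) hri
  have hR0 : 0 ≤ ∫ t in a..b, r t := by
    rw [integral_of_le hab.le, integral_Ioc_eq_integral_Ioo]
    exact setIntegral_nonneg measurableSet_Ioo fun x hx => (hrpos x hx).le
  calc ∫ x in a..b, r x * (∫ t in x..b, f t) ^ 2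
      ≤ ∫ x in a..b, r x * (∫ t in a..b, f t) ^ 2 := by
        refine integral_mono_on_of_le_Ioo hab.le h1 (hri.mul_const _) fun x hx => ?_
        have hx0 : 0 ≤ ∫ t in x..b, f t := by
          rw [integral_of_le hx.2.le]
          exact integral_nonneg_of_ae
            (ae_restrict_of_ae_restrict_of_subset (Ioc_subset_Ioc_left hx.1.le) hf0')
        have hxF := integral_mono_interval hx.1.le hx.2.le le_rfl hf0' hfi
        exact mul_le_mul_of_nonneg_left (pow_le_pow_left₀ hx0 hxF 2) (hrpos x hx).le
    _ = (∫ x in a..b, r x) * (∫ t in a..b, f t) ^ 2 := integral_mul_const _ _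
    _ ≤ sSup ((fun x => ∫ t in a..x, r t) '' Ioo a b) * (A ^ (2 / p) * B ^ (2 / q)) :=
        mul_le_mul hR hF2 (sq_nonneg _) (hR0.trans hR)
    _ = _ := (mul_assoc _ _ _).symm
end

section
/- Let a < b be real numbers, let r and s be positive continuous functions on the interval (a,b), and let p be a positive integer, with ∫_a^b s(x)^{−1/p} dx < ∞. Then for every nonnegative measurable function f on (a,b) for which all the integrals below exist and are finite, ∫_a^b r(x)(∫_a^x f(t) dt)^{p+1} dx ≤ C · ∫_a^b s(x) f(x)^{p+1} dx, where C = sup_{a<x<b} (∫_x^b r(t) dt) · (∫_a^b s(x)^{−1/p} dx)^p. -/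
open MeasureTheory intervalIntegral Set

/-- The graph of `t ↦ t ^ (n + 1)` on `[0, ∞)` lies above its tangent at `m`. -/
lemma tangent_le_pow_succ {m g : ℝ} (hm : 0 ≤ m) (hg : 0 ≤ g) (n : ℕ) :
    m ^ (n + 1) + (n + 1) * m ^ n * (g - m) ≤ g ^ (n + 1) := by
  induction n with
  | zero => simp
  | succ n ih =>
    have h := mul_le_mul_of_nonneg_right ih hg
    have h' : 0 ≤ ((n : ℝ) + 1) * m ^ n * (g - m) ^ 2 := by positivity
    push_cast
    ring_nf at h h' ⊢
    linarith

lemma intervalIntegral_nonneg_of_nonneg_on_Ioo {f : ℝ → ℝ} {a b : ℝ} (hab : a ≤ b)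
    (hf : IntervalIntegrable f volume a b) (h : ∀ x ∈ Ioo a b, 0 ≤ f x) :
    0 ≤ ∫ x in a..b, f x := by
  simpa using integral_mono_on_of_le_Ioo hab (by simp) hf h

/-- Hölder's inequality with weight `u ^ (-p)`, for exponents `p + 1` and `(p + 1) / p`;
the weight is given as a function `s` with `s * u ^ p = 1`. -/
lemma integral_pow_succ_le {a b : ℝ} (hab : a < b) (p : ℕ) {s u f : ℝ → ℝ}
    (hu : IntervalIntegrable u volume a b) (hupos : ∀ x ∈ Ioo a b, 0 < u x)
    (hsu : ∀ x ∈ Ioo a b, s x * u x ^ p = 1)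
    (hf : IntervalIntegrable f volume a b) (hfnonneg : ∀ x ∈ Ioo a b, 0 ≤ f x)
    (hsf : IntervalIntegrable (fun x => s x * f x ^ (p + 1)) volume a b) :
    (∫ x in a..b, f x) ^ (p + 1) ≤
      (∫ x in a..b, u x) ^ p * ∫ x in a..b, s x * f x ^ (p + 1) := by
  have hS : 0 < ∫ x in a..b, u x := intervalIntegral_pos_of_pos_on hu hupos hab
  have hF := intervalIntegral_nonneg_of_nonneg_on_Ioo hab.le hf hfnonneg
  set S := ∫ x in a..b, u x with hSdef
  set F := ∫ x in a..b, f x with hFdef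
  have hm : 0 ≤ F / S := by positivity
  set m := F / S with hmdef
  have hmS : F = m * S := by rw [hmdef]; field_simp
  have hint : IntervalIntegrable
      (fun x => m ^ (p + 1) * u x + (p + 1) * m ^ p * (f x - m * u x)) volume a b :=
    (hu.const_mul _).add ((hf.sub (hu.const_mul _)).const_mul _)
  have key := integral_mono_on_of_le_Ioo hab.le hint hsf fun x hx => by
    have hux := hupos x hx
    have ht := mul_le_mul_of_nonneg_left
      (tangent_le_pow_succ hm (div_nonneg (hfnonneg x hx) hux.le) p) hux.le
    have hs : s x = (u x ^ p)⁻¹ := eq_inv_of_mul_eq_one_left (hsu x hx)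
    have hr : u x * (f x / u x) ^ (p + 1) = s x * f x ^ (p + 1) := by
      rw [hs, div_pow, pow_succ (u x)]
      field_simp
    have hl : u x * (m ^ (p + 1) + (p + 1) * m ^ p * (f x / u x - m)) =
        m ^ (p + 1) * u x + (p + 1) * m ^ p * (f x - m * u x) := by
      field_simp
    rwa [hr, hl] at ht
  rw [integral_add (hu.const_mul _) ((hf.sub (hu.const_mul _)).const_mul _),
    intervalIntegral.integral_const_mul, intervalIntegral.integral_const_mul,
    integral_sub hf (hu.const_mul _),
    intervalIntegral.integral_const_mul, ← hSdef, ← hFdef, hmS, sub_self, mul_zero, add_zero] at key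
  calc F ^ (p + 1) = S ^ p * (m ^ (p + 1) * S) := by rw [hmS]; ring
    _ ≤ _ := by gcongr

lemma integral_le_sSup_integral_right {a b : ℝ} (hab : a < b) {r : ℝ → ℝ}
    (hr : IntervalIntegrable r volume a b) (hrnonneg : ∀ x ∈ Ioo a b, 0 ≤ r x) :
    ∫ t in a..b, r t ≤ sSup ((fun x => ∫ t in x..b, r t) '' Ioo a b) := by
  have hleft : ∀ x ∈ Icc a b, IntervalIntegrable r volume a x := fun x hx =>
    hr.mono_set (by rw [uIcc_of_le hx.1, uIcc_of_le hab.le]; exact Icc_subset_Icc_right hx.2)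
  have hsplit : ∀ x ∈ Icc a b, ∫ t in x..b, r t = (∫ t in a..b, r t) - ∫ t in a..x, r t :=
    fun x hx => (integral_interval_sub_left hr (hleft x hx)).symm
  have hbdd : BddAbove ((fun x => ∫ t in x..b, r t) '' Ioo a b) := by
    refine ⟨∫ t in a..b, r t, ?_⟩
    rintro _ ⟨x, hx, rfl⟩
    have := intervalIntegral_nonneg_of_nonneg_on_Ioo hx.1.le (hleft x (Ioo_subset_Icc_self hx))
      fun t ht => hrnonneg t ⟨ht.1, ht.2.trans hx.2⟩
    have := hsplit x (Ioo_subset_Icc_self hx)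
    dsimp only
    linarith
  have hcont : ContinuousOn (fun x => ∫ t in a..x, r t) (Icc a b) := by
    have := continuousOn_primitive_interval
      ((intervalIntegrable_iff' (by finiteness)).1 hr)
    rwa [uIcc_of_le hab.le] at this
  have hlim : Filter.Tendsto (fun x => (∫ t in a..b, r t) - ∫ t in a..x, r t)
      (nhdsWithin a (Ioo a b)) (nhds (∫ t in a..b, r t)) := by
    have := ((hcont a (left_mem_Icc.2 hab.le)).mono Ioo_subset_Icc_self).tendsto.const_sub
      (∫ t in a..b, r t)
    simpa using this
  have : (nhdsWithin a (Ioo a b)).NeBot := left_nhdsWithin_Ioo_neBot hab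
  refine le_of_tendsto hlim ?_
  filter_upwards [self_mem_nhdsWithin] with x hx
  rw [← hsplit x (Ioo_subset_Icc_self hx)]
  exact le_csSup hbdd (mem_image_of_mem _ hx)

/-- Theorem 2.14: For positive continuous `r, s` on `(a,b)`, a positive integer `p`,
with `∫_a^b s(x)^(−1/p) dx < ∞`, and nonnegative measurable `f` (all integrals
existing and finite), `∫_a^b r(x)(∫_a^x f)^(p+1) dx ≤ C · ∫_a^b s(x) f(x)^(p+1) dx`,
where `C = sup_{a<x<b} (∫_x^b r) · (∫_a^b s^(−1/p))^p`. -/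
theorem hardy_type_thm_2_14 (a b : ℝ) (hab : a < b) (p : ℕ) (hp : 0 < p) (r s f : ℝ → ℝ)
    (hr : ContinuousOn r (Ioo a b)) (hrpos : ∀ x ∈ Ioo a b, 0 < r x)
    (hs : ContinuousOn s (Ioo a b)) (hspos : ∀ x ∈ Ioo a b, 0 < s x)
    (hsint : IntervalIntegrable (fun x => s x ^ (-(1 : ℝ) / p)) volume a b)
    (hfmeas : Measurable f) (hfnonneg : ∀ x ∈ Ioo a b, 0 ≤ f x)
    (hfi : IntervalIntegrable f volume a b)
    (hri : IntervalIntegrable r volume a b)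
    (h1 : IntervalIntegrable (fun x => r x * (∫ t in a..x, f t) ^ (p + 1)) volume a b)
    (h2 : IntervalIntegrable (fun x => s x * f x ^ (p + 1)) volume a b) :
    ∫ x in a..b, r x * (∫ t in a..x, f t) ^ (p + 1) ≤
      (sSup ((fun x => ∫ t in x..b, r t) '' Ioo a b) *
          (∫ x in a..b, s x ^ (-(1 : ℝ) / p)) ^ p) *
        ∫ x in a..b, s x * f x ^ (p + 1) := by
  have hp' : (p : ℝ) ≠ 0 := by positivity
  have hholder := integral_pow_succ_le hab p hsint
    (fun x hx => Real.rpow_pos_of_pos (hspos x hx) _)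
    (fun x hx => by
      rw [← Real.rpow_mul_natCast (hspos x hx).le, div_mul_cancel₀ _ hp', Real.rpow_neg_one,
        mul_inv_cancel₀ (hspos x hx).ne'])
    hfi hfnonneg h2
  have hF := intervalIntegral_nonneg_of_nonneg_on_Ioo hab.le hfi hfnonneg
  have hsup := integral_le_sSup_integral_right hab hri fun x hx => (hrpos x hx).le
  have hR := intervalIntegral_nonneg_of_nonneg_on_Ioo hab.le hri fun x hx => (hrpos x hx).le
  calc ∫ x in a..b, r x * (∫ t in a..x, f t) ^ (p + 1)
      ≤ ∫ x in a..b, r x * (∫ t in a..b, f t) ^ (p + 1) := by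
        refine integral_mono_on_of_le_Ioo hab.le h1 (hri.mul_const _) fun x hx => ?_
        have hx' : x ∈ uIcc a b := by
          rw [uIcc_of_le hab.le]
          exact Ioo_subset_Icc_self hx
        have hl : IntervalIntegrable f volume a x := hfi.mono_set (uIcc_subset_uIcc_left hx')
        have hr' : IntervalIntegrable f volume x b := hfi.mono_set (uIcc_subset_uIcc_right hx')
        have hl0 := intervalIntegral_nonneg_of_nonneg_on_Ioo hx.1.le hl
          fun t ht => hfnonneg t ⟨ht.1, ht.2.trans hx.2⟩
        have hr0 := intervalIntegral_nonneg_of_nonneg_on_Ioo hx.2.le hr'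
          fun t ht => hfnonneg t ⟨hx.1.trans ht.1, ht.2⟩
        have hadd := integral_add_adjacent_intervals hl hr'
        have hle : ∫ t in a..x, f t ≤ ∫ t in a..b, f t := by linarith
        exact mul_le_mul_of_nonneg_left (pow_le_pow_left₀ hl0 hle _) (hrpos x hx).le
    _ = (∫ x in a..b, r x) * (∫ t in a..b, f t) ^ (p + 1) := integral_mul_const _ _
    _ ≤ sSup ((fun x => ∫ t in x..b, r t) '' Ioo a b) *
          ((∫ x in a..b, s x ^ (-(1 : ℝ) / p)) ^ p * ∫ x in a..b, s x * f x ^ (p + 1)) :=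
        mul_le_mul hsup hholder (by positivity) (hR.trans hsup)
    _ = _ := (mul_assoc _ _ _).symm
end

section
/- Let a < b be real numbers, let r be a positive continuous function on the interval (a,b), and let p > 1 be an integer (with conjugate exponent q = p/(p−1)). Then for every nonnegative measurable function f on (a,b) for which all the integrals below exist and are finite, ∫_a^b r(x)(∫_a^x f(t) dt)^{p+1} dx ≤ C · (∫_a^b f(x)^{p(p+1)/(p−1)} dx)^{(p−1)/p}, where C = (p+1)^{1/p} (b−a)^p (∫_a^b R(x,b)^p dx)^{1/p}. -/
open MeasureTheory intervalIntegral Set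

theorem memLp_ofReal_of_integrable_rpow {α : Type*} [MeasurableSpace α] {μ : Measure α}
    {f : α → ℝ} {s : ℝ} (hs : 0 < s) (hf : AEStronglyMeasurable f μ) (hf0 : 0 ≤ᵐ[μ] f)
    (hfs : Integrable (fun x => f x ^ s) μ) : MemLp f (ENNReal.ofReal s) μ := by
  rw [← integrable_norm_rpow_iff hf (by simpa using hs) ENNReal.ofReal_ne_top,
    ENNReal.toReal_ofReal hs.le]
  refine hfs.congr ?_
  filter_upwards [hf0] with x hx
  rw [Real.norm_of_nonneg hx]

theorem intervalIntegral_nonneg_of_ae_restrict_Ioc {f : ℝ → ℝ} {a b : ℝ} (hab : a ≤ b)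
    (hf : 0 ≤ᵐ[volume.restrict (Ioc a b)] f) : 0 ≤ ∫ x in a..b, f x := by
  rw [integral_of_le hab]
  exact integral_nonneg_of_ae hf

/-- Jensen's inequality for `x ↦ x ^ s` on an interval. -/
theorem rpow_intervalIntegral_le {a b s : ℝ} (hab : a ≤ b) (hs : 1 < s) {f : ℝ → ℝ}
    (hf : AEStronglyMeasurable f (volume.restrict (Ioc a b)))
    (hf0 : 0 ≤ᵐ[volume.restrict (Ioc a b)] f)
    (hfs : IntervalIntegrable (fun x => f x ^ s) volume a b) :
    (∫ x in a..b, f x) ^ s ≤ (b - a) ^ (s - 1) * ∫ x in a..b, f x ^ s := by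
  have hs0 : 0 < s := by linarith
  have hconj := Real.HolderConjugate.conjExponent hs
  have hint : 0 ≤ ∫ x in Ioc a b, f x ^ s :=
    integral_nonneg_of_ae (hf0.mono fun x hx => Real.rpow_nonneg hx s)
  have holder := integral_mul_le_Lp_mul_Lq_of_nonneg hconj hf0
    (Filter.Eventually.of_forall fun _ => zero_le_one)
    (memLp_ofReal_of_integrable_rpow hs0 hf hf0
      ((intervalIntegrable_iff_integrableOn_Ioc_of_le hab).1 hfs))
    (memLp_const (1 : ℝ))
  simp only [mul_one, Real.one_rpow, MeasureTheory.integral_const, smul_eq_mul,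
    measureReal_restrict_apply_univ,
    Real.volume_real_Ioc_of_le hab] at holder
  rw [integral_of_le hab, integral_of_le hab]
  calc (∫ x in Ioc a b, f x) ^ s
      ≤ ((∫ x in Ioc a b, f x ^ s) ^ (1 / s) * (b - a) ^ (1 / s.conjExponent)) ^ s :=
        Real.rpow_le_rpow (integral_nonneg_of_ae hf0) holder hs0.le
    _ = (b - a) ^ (s - 1) * ∫ x in Ioc a b, f x ^ s := by
        have hba : 0 ≤ b - a := by linarith
        have he : 1 / s.conjExponent * s = s - 1 := by
          have : s - 1 ≠ 0 := by linarith
          rw [Real.conjExponent]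
          field_simp
        rw [Real.mul_rpow (by positivity) (by positivity), ← Real.rpow_mul hint,
          ← Real.rpow_mul hba, one_div_mul_cancel hs0.ne', Real.rpow_one, he, mul_comm]

theorem AbsolutelyContinuousOnInterval.fun_pow {f : ℝ → ℝ} {a b : ℝ}
    (hf : AbsolutelyContinuousOnInterval f a b) (n : ℕ) :
    AbsolutelyContinuousOnInterval (fun x => f x ^ (n + 1)) a b := by
  induction n with
  | zero => simpa using hf
  | succ n ih => simpa only [pow_succ _ (n + 1)] using ih.fun_mul hf

theorem ae_deriv_pow_intervalIntegral {f : ℝ → ℝ} {a b : ℝ}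
    (hf : IntervalIntegrable f volume a b) (n : ℕ) :
    ∀ᵐ x, x ∈ uIoc a b → deriv (fun x => (∫ t in a..x, f t) ^ (n + 1)) x =
      ((n : ℝ) + 1) * ((∫ t in a..x, f t) ^ n * f x) := by
  filter_upwards [hf.ae_hasDerivAt_integral] with x hx hxab
  have := (hx (uIoc_subset_uIcc hxab) a left_mem_uIcc).fun_pow (n + 1)
  rw [this.deriv]
  push_cast
  exact mul_assoc _ _ _

theorem integral_pow_mul_intervalIntegral {f : ℝ → ℝ} {a b : ℝ}
    (hf : IntervalIntegrable f volume a b) (n : ℕ) :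
    ((n : ℝ) + 1) * ∫ x in a..b, (∫ t in a..x, f t) ^ n * f x =
      (∫ x in a..b, f x) ^ (n + 1) := by
  have h := ((hf.absolutelyContinuousOnInterval_intervalIntegral left_mem_uIcc).fun_pow
    n).integral_deriv_eq_sub
  rw [integral_congr_ae (ae_deriv_pow_intervalIntegral hf n)] at h
  simpa [intervalIntegral.integral_const_mul] using h

theorem integral_mul_pow_intervalIntegral_eq {r f : ℝ → ℝ} {a b : ℝ}
    (hr : IntervalIntegrable r volume a b) (hf : IntervalIntegrable f volume a b) (n : ℕ) :
    ∫ x in a..b, r x * (∫ t in a..x, f t) ^ (n + 1) =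
      ((n : ℝ) + 1) * ∫ x in a..b, (∫ t in x..b, r t) * ((∫ t in a..x, f t) ^ n * f x) := by
  have hF := (hf.absolutelyContinuousOnInterval_intervalIntegral left_mem_uIcc).fun_pow n
  have hR := hr.absolutelyContinuousOnInterval_intervalIntegral right_mem_uIcc
  have h := hR.integral_mul_deriv_eq_deriv_mul hF
  have hR' : ∀ᵐ x, x ∈ uIoc a b →
      deriv (fun x => ∫ t in b..x, r t) x * (∫ t in a..x, f t) ^ (n + 1) =
        r x * (∫ t in a..x, f t) ^ (n + 1) := by
    filter_upwards [hr.ae_hasDerivAt_integral] with x hx hxab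
    rw [(hx (uIoc_subset_uIcc hxab) b right_mem_uIcc).deriv]
  have hF' : ∀ᵐ x, x ∈ uIoc a b →
      (∫ t in b..x, r t) * deriv (fun x => (∫ t in a..x, f t) ^ (n + 1)) x =
        -(((n : ℝ) + 1) * ((∫ t in x..b, r t) * ((∫ t in a..x, f t) ^ n * f x))) := by
    filter_upwards [ae_deriv_pow_intervalIntegral hf n] with x hx hxab
    rw [hx hxab, integral_symm x b]
    ring
  rw [integral_congr_ae hR', integral_congr_ae hF', intervalIntegral.integral_neg,
    intervalIntegral.integral_const_mul] at h
  simp only [integral_same, zero_mul, ne_eq, Nat.add_eq_zero_iff, one_ne_zero, and_false,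
    not_false_eq_true, zero_pow, mul_zero, sub_self, zero_sub, neg_inj] at h
  exact h.symm

/-- An Opial type inequality. -/
theorem integral_pow_mul_rpow_le {a b p q : ℝ} {n : ℕ} {f : ℝ → ℝ} (hab : a ≤ b)
    (hn : p = n) (hpq : p.HolderConjugate q)
    (hf : AEStronglyMeasurable f (volume.restrict (Ioc a b)))
    (hf0 : 0 ≤ᵐ[volume.restrict (Ioc a b)] f)
    (hfq : IntervalIntegrable (fun x => f x ^ q) volume a b)
    (hfqp : IntervalIntegrable (fun x => f x ^ (q * (p + 1))) volume a b) :
    ∫ x in a..b, ((∫ t in a..x, f t) ^ n * f x) ^ q ≤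
      (b - a) ^ (q + p) / (p + 1) * ∫ x in a..b, f x ^ (q * (p + 1)) := by
  have hp1 := hpq.lt
  have hq1 := hpq.symm.lt
  have hba : 0 ≤ b - a := by linarith
  have hH := hfq.absolutelyContinuousOnInterval_intervalIntegral (c := a) left_mem_uIcc
  have hbound : ∀ᵐ x ∂volume.restrict (Ioc a b), ((∫ t in a..x, f t) ^ n * f x) ^ q ≤
      (b - a) ^ q * ((∫ t in a..x, f t ^ q) ^ n * f x ^ q) := by
    filter_upwards [hf0, ae_restrict_mem measurableSet_Ioc] with x hx hxab
    have hsub : Ioc a x ⊆ Ioc a b := Ioc_subset_Ioc_right hxab.2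
    have hf0x := ae_restrict_of_ae_restrict_of_subset hsub hf0
    have hF0 : 0 ≤ ∫ t in a..x, f t := intervalIntegral_nonneg_of_ae_restrict_Ioc hxab.1.le hf0x
    have hH0 : 0 ≤ ∫ t in a..x, f t ^ q :=
      intervalIntegral_nonneg_of_ae_restrict_Ioc hxab.1.le
        (hf0x.mono fun x hx => Real.rpow_nonneg hx q)
    have hJ := rpow_intervalIntegral_le hxab.1.le hq1 (hf.mono_measure
      (Measure.restrict_mono hsub le_rfl)) hf0x (hfq.mono_set (by
        rw [uIcc_of_le hxab.1.le, uIcc_of_le hab]; exact Icc_subset_Icc_right hxab.2))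
    have hxa : 0 ≤ x - a := by linarith [hxab.1]
    rw [Real.mul_rpow (by positivity) hx, ← mul_assoc]
    refine mul_le_mul_of_nonneg_right ?_ (Real.rpow_nonneg hx q)
    calc ((∫ t in a..x, f t) ^ n) ^ q = ((∫ t in a..x, f t) ^ q) ^ n := by
          rw [← Real.rpow_natCast_mul hF0, ← Real.rpow_mul_natCast hF0, mul_comm]
      _ ≤ ((x - a) ^ (q - 1) * ∫ t in a..x, f t ^ q) ^ n := by
          gcongr
      _ = (x - a) ^ q * (∫ t in a..x, f t ^ q) ^ n := by
          rw [mul_pow, ← Real.rpow_mul_natCast hxa, ← hn, sub_mul, hpq.symm.mul_eq_add]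
          ring_nf
      _ ≤ (b - a) ^ q * (∫ t in a..x, f t ^ q) ^ n := by
          gcongr
          exact hxab.2
  have hHint : IntervalIntegrable (fun x => (∫ t in a..x, f t ^ q) ^ n * f x ^ q) volume a b :=
    hfq.continuousOn_mul (hH.continuousOn.pow n)
  have hJ := rpow_intervalIntegral_le (f := fun x => f x ^ q) (s := p + 1) hab (by linarith)
    ((hf.aemeasurable.pow_const q).aestronglyMeasurable)
    (hf0.mono fun x hx => Real.rpow_nonneg hx q)
    (by
      refine hfqp.congr_ae ?_
      rw [uIoc_of_le hab]
      filter_upwards [hf0] with x hx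
      rw [Real.rpow_mul hx])
  have hcongr : ∫ x in a..b, (f x ^ q) ^ (p + 1) = ∫ x in a..b, f x ^ (q * (p + 1)) := by
    rw [integral_of_le hab, integral_of_le hab]
    refine MeasureTheory.integral_congr_ae ?_
    filter_upwards [hf0] with x hx
    rw [Real.rpow_mul hx]
  rw [hcongr, add_sub_cancel_right] at hJ
  have hpow := integral_pow_mul_intervalIntegral hfq n
  rw [← hn] at hpow
  have hnat : (∫ x in a..b, f x ^ q) ^ (p + 1) = (∫ x in a..b, f x ^ q) ^ (n + 1) := by
    rw [← Real.rpow_natCast, hn]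
    push_cast
    rfl
  rw [hnat, ← hpow] at hJ
  have hp0 : 0 < p + 1 := by linarith
  calc ∫ x in a..b, ((∫ t in a..x, f t) ^ n * f x) ^ q
      ≤ ∫ x in a..b, (b - a) ^ q * ((∫ t in a..x, f t ^ q) ^ n * f x ^ q) := by
        rw [integral_of_le hab, integral_of_le hab]
        refine integral_mono_of_nonneg ?_
          ((intervalIntegrable_iff_integrableOn_Ioc_of_le hab).1 (hHint.const_mul _)) hbound
        filter_upwards [hf0, ae_restrict_mem measurableSet_Ioc] with x hx hxab
        have : 0 ≤ ∫ t in a..x, f t := intervalIntegral_nonneg_of_ae_restrict_Ioc hxab.1.le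
          (ae_restrict_of_ae_restrict_of_subset (Ioc_subset_Ioc_right hxab.2) hf0)
        exact Real.rpow_nonneg (mul_nonneg (pow_nonneg this n) hx) q
    _ = (b - a) ^ q / (p + 1) *
          ((p + 1) * ∫ x in a..b, (∫ t in a..x, f t ^ q) ^ n * f x ^ q) := by
        rw [intervalIntegral.integral_const_mul]
        field_simp
    _ ≤ (b - a) ^ q / (p + 1) * ((b - a) ^ p * ∫ x in a..b, f x ^ (q * (p + 1))) := by
        gcongr
    _ = (b - a) ^ (q + p) / (p + 1) * ∫ x in a..b, f x ^ (q * (p + 1)) := by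
        rw [Real.rpow_add_of_nonneg hba (by linarith) (by linarith)]
        ring

/-- Theorem 2.16: For positive continuous `r` on `(a,b)`, an integer `p > 1`, and
nonnegative measurable `f` (all integrals existing and finite),
`∫_a^b r(x)(∫_a^x f)^(p+1) dx ≤ C · (∫_a^b f^(p(p+1)/(p−1)))^((p−1)/p)`, where
`C = (p+1)^(1/p) (b−a)^p (∫_a^b R(x,b)^p dx)^(1/p)` and `R(x,b) = ∫_x^b r(t) dt`. -/
theorem hardy_type_thm_2_16 (a b : ℝ) (hab : a < b) (p : ℕ) (hp : 1 < p) (r f : ℝ → ℝ)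
    (hr : ContinuousOn r (Ioo a b)) (hrpos : ∀ x ∈ Ioo a b, 0 < r x)
    (hfmeas : Measurable f) (hfnonneg : ∀ x ∈ Ioo a b, 0 ≤ f x)
    (hfi : IntervalIntegrable f volume a b)
    (hri : IntervalIntegrable r volume a b)
    (h1 : IntervalIntegrable (fun x => r x * (∫ t in a..x, f t) ^ (p + 1)) volume a b)
    (h2 : IntervalIntegrable (fun x => (∫ t in x..b, r t) ^ p) volume a b)
    (h3 : IntervalIntegrable
      (fun x => f x ^ (((p : ℝ) * ((p : ℝ) + 1)) / ((p : ℝ) - 1))) volume a b) :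
    ∫ x in a..b, r x * (∫ t in a..x, f t) ^ (p + 1) ≤
      (((p : ℝ) + 1) ^ ((1 : ℝ) / p) * (b - a) ^ p *
          (∫ x in a..b, (∫ t in x..b, r t) ^ p) ^ ((1 : ℝ) / p)) *
        (∫ x in a..b, f x ^ (((p : ℝ) * ((p : ℝ) + 1)) / ((p : ℝ) - 1))) ^
          (((p : ℝ) - 1) / p) := by
  have hp1 : (1 : ℝ) < p := by exact_mod_cast hp
  have hpm : (p : ℝ) - 1 ≠ 0 := by linarith
  have hpq := Real.HolderConjugate.conjExponent hp1
  set q : ℝ := (p : ℝ).conjExponent with hq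
  have hq1 := hpq.symm.lt
  have hexp : ((p : ℝ) * ((p : ℝ) + 1)) / ((p : ℝ) - 1) = q * (p + 1) := by
    rw [hq, Real.conjExponent]
    ring
  have hqinv : ((p : ℝ) - 1) / p = 1 / q := by
    rw [hq, Real.conjExponent, one_div_div]
  rw [hexp] at h3 ⊢
  rw [hqinv]
  have hba : 0 ≤ b - a := by linarith
  have hf0 : 0 ≤ᵐ[volume.restrict (Ioc a b)] f := by
    rw [← restrict_Ioo_eq_restrict_Ioc]
    exact (ae_restrict_mem measurableSet_Ioo).mono hfnonneg
  have hr0 : 0 ≤ᵐ[volume.restrict (Ioc a b)] r := by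
    rw [← restrict_Ioo_eq_restrict_Ioc]
    exact (ae_restrict_mem measurableSet_Ioo).mono fun x hx => (hrpos x hx).le
  have hfm : AEStronglyMeasurable f (volume.restrict (Ioc a b)) := hfmeas.aestronglyMeasurable
  have hfq : MemLp f (ENNReal.ofReal q) (volume.restrict (Ioc a b)) :=
    (memLp_ofReal_of_integrable_rpow (by positivity) hfm hf0
      ((intervalIntegrable_iff_integrableOn_Ioc_of_le hab.le).1 h3)).mono_exponent
      (ENNReal.ofReal_le_ofReal (by nlinarith))
  have hfqi : IntervalIntegrable (fun x => f x ^ q) volume a b := by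
    rw [intervalIntegrable_iff_integrableOn_Ioc_of_le hab.le]
    have := (integrable_norm_rpow_iff hfm (by simpa using by linarith)
      ENNReal.ofReal_ne_top).2 hfq
    rw [ENNReal.toReal_ofReal (by linarith)] at this
    refine this.congr ?_
    filter_upwards [hf0] with x hx
    rw [Real.norm_of_nonneg hx]
  have hF0 : ∀ x ∈ Ioc a b, 0 ≤ ∫ t in a..x, f t := fun x hx =>
    intervalIntegral_nonneg_of_ae_restrict_Ioc hx.1.le
      (ae_restrict_of_ae_restrict_of_subset (Ioc_subset_Ioc_right hx.2) hf0)
  have hR0 : ∀ x ∈ Ioc a b, 0 ≤ ∫ t in x..b, r t := fun x hx =>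
    intervalIntegral_nonneg_of_ae_restrict_Ioc hx.2
      (ae_restrict_of_ae_restrict_of_subset (Ioc_subset_Ioc_left hx.1.le) hr0)
  have hFc : ContinuousOn (fun x => (∫ t in a..x, f t) ^ p) (Icc a b) := by
    rw [← uIcc_of_le hab.le]
    exact (hfi.absolutelyContinuousOnInterval_intervalIntegral left_mem_uIcc).continuousOn.pow p
  have hRc : ContinuousOn (fun x => ∫ t in x..b, r t) (Icc a b) := by
    simp only [fun x => integral_symm (f := r) (μ := volume) b x]
    rw [← uIcc_of_le hab.le]
    exact (hri.absolutelyContinuousOnInterval_intervalIntegral right_mem_uIcc).continuousOn.neg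
  have hFmem : MemLp (fun x => (∫ t in a..x, f t) ^ p * f x) (ENNReal.ofReal q)
      (volume.restrict (Ioc a b)) := by
    obtain ⟨C, hC⟩ := isCompact_Icc.exists_bound_of_continuousOn hFc
    refine hfq.of_le_mul (c := C)
      (((hFc.mono Ioc_subset_Icc_self).aestronglyMeasurable measurableSet_Ioc).mul hfm) ?_
    filter_upwards [ae_restrict_mem measurableSet_Ioc] with x hx
    rw [norm_mul]
    exact mul_le_mul_of_nonneg_right (hC x (Ioc_subset_Icc_self hx)) (norm_nonneg _)
  have hRmem : MemLp (fun x => ∫ t in x..b, r t) (ENNReal.ofReal p)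
      (volume.restrict (Ioc a b)) := by
    obtain ⟨C, hC⟩ := isCompact_Icc.exists_bound_of_continuousOn hRc
    refine MemLp.of_bound ((hRc.mono Ioc_subset_Icc_self).aestronglyMeasurable measurableSet_Ioc)
      C ?_
    filter_upwards [ae_restrict_mem measurableSet_Ioc] with x hx
    exact hC x (Ioc_subset_Icc_self hx)
  have hFf0 : 0 ≤ᵐ[volume.restrict (Ioc a b)] fun x => (∫ t in a..x, f t) ^ p * f x := by
    filter_upwards [hf0, ae_restrict_mem measurableSet_Ioc] with x hx hxab
    exact mul_nonneg (pow_nonneg (hF0 x hxab) p) hx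
  have holder := integral_mul_le_Lp_mul_Lq_of_nonneg hpq
    ((ae_restrict_mem measurableSet_Ioc).mono hR0) hFf0 hRmem hFmem
  simp only [← integral_of_le hab.le, Real.rpow_natCast] at holder
  have hopial := integral_pow_mul_rpow_le hab.le rfl hpq hfm hf0 hfqi h3
  have hRint : 0 ≤ ∫ x in a..b, (∫ t in x..b, r t) ^ p :=
    intervalIntegral_nonneg_of_ae_restrict_Ioc hab.le
      ((ae_restrict_mem measurableSet_Ioc).mono fun x hx => pow_nonneg (hR0 x hx) p)
  have hFint : 0 ≤ ∫ x in a..b, ((∫ t in a..x, f t) ^ p * f x) ^ q :=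
    intervalIntegral_nonneg_of_ae_restrict_Ioc hab.le
      (hFf0.mono fun x hx => Real.rpow_nonneg hx q)
  have hfint : 0 ≤ ∫ x in a..b, f x ^ (q * (p + 1)) :=
    intervalIntegral_nonneg_of_ae_restrict_Ioc hab.le
      (hf0.mono fun x hx => Real.rpow_nonneg hx _)
  have hconst : ((p : ℝ) + 1) * ((b - a) ^ (q + p) / (p + 1)) ^ (1 / q) =
      ((p : ℝ) + 1) ^ ((1 : ℝ) / p) * (b - a) ^ p := by
    have h1q : 1 / q = 1 - 1 / (p : ℝ) := by
      rw [← hqinv]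
      field_simp
    have he : (q + p) * (1 / q) = p := by
      rw [← hpq.symm.mul_eq_add]
      field_simp
    rw [Real.div_rpow (by positivity) (by positivity), ← Real.rpow_mul hba, he,
      Real.rpow_natCast, h1q, Real.rpow_sub (by positivity), Real.rpow_one]
    field_simp
  rw [integral_mul_pow_intervalIntegral_eq hri hfi]
  calc ((p : ℝ) + 1) * ∫ x in a..b, (∫ t in x..b, r t) * ((∫ t in a..x, f t) ^ p * f x)
      ≤ ((p : ℝ) + 1) * ((∫ x in a..b, (∫ t in x..b, r t) ^ p) ^ ((1 : ℝ) / p) *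
          ((b - a) ^ (q + p) / (p + 1) * ∫ x in a..b, f x ^ (q * (p + 1))) ^ (1 / q)) := by
        refine mul_le_mul_of_nonneg_left (holder.trans ?_) (by positivity)
        gcongr
    _ = _ := by
        rw [Real.mul_rpow (by positivity) hfint, ← hconst]
        ring
end

section
/- Let a < b be real numbers, let r be a positive continuous function on the interval (a,b), and let p ≥ 0 be an integer. Then for every nonnegative measurable function f on (a,b) for which all the integrals below exist and are finite, ∫_a^b r(x)(∫_a^x f(t) dt)^{p+1} dx ≤ (b−a)^p · ∫_a^b R(x,b) f(x)^{p+1} dx. -/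
open MeasureTheory intervalIntegral Set

/-- Jensen's inequality for powers:
`(∫ f)^(p+1) ≤ μ(univ)^p * ∫ f^(p+1)`. -/
lemma lintegral_pow_succ_le {α : Type*} [MeasurableSpace α] (μ : Measure α)
    (p : ℕ) {f : α → ENNReal} (hf : AEMeasurable f μ) :
    (∫⁻ x, f x ∂μ) ^ (p + 1) ≤ μ univ ^ p * ∫⁻ x, f x ^ (p + 1) ∂μ := by
  have hp : (0 : ℝ) < (p : ℝ) + 1 := by positivity
  have h := eLpNorm'_le_eLpNorm'_mul_rpow_measure_univ (μ := μ) (f := f) (p := 1)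
    (q := (p : ℝ) + 1) one_pos (by linarith [p.cast_nonneg (α := ℝ)]) hf.aestronglyMeasurable
  have h' := pow_le_pow_left' h (p + 1)
  simp only [eLpNorm', enorm_eq_self, ENNReal.rpow_one, div_one] at h'
  refine h'.trans_eq ?_
  rw [mul_pow, ← ENNReal.rpow_mul_natCast, ← ENNReal.rpow_mul_natCast, mul_comm]
  push_cast
  congr 1
  · rw [← ENNReal.rpow_natCast]
    congr 1
    field_simp
    ring
  · rw [one_div_mul_cancel hp.ne', ENNReal.rpow_one]
    exact_mod_cast rfl

/-- Tonelli on the triangle `a < t ≤ x ≤ b`. -/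
lemma lintegral_mul_lintegral_Ioc_swap (a b : ℝ) {r g : ℝ → ENNReal}
    (hr : AEMeasurable r (volume.restrict (Ioc a b))) (hg : Measurable g) :
    ∫⁻ x in Ioc a b, r x * ∫⁻ t in Ioc a x, g t =
      ∫⁻ t in Ioc a b, (∫⁻ x in Ioc t b, r x) * g t := by
  set μ := volume.restrict (Ioc a b) with hμ
  have hmeas : AEMeasurable (Function.uncurry fun x t : ℝ =>
      r x * (Iic x).indicator g t) (μ.prod μ) := by
    refine (hr.comp_fst).mul ?_
    have : (fun z : ℝ × ℝ => (Iic z.1).indicator g z.2) =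
        {z : ℝ × ℝ | z.2 ≤ z.1}.indicator fun z => g z.2 := by
      ext z
      simp [indicator]
    rw [this]
    exact ((hg.comp measurable_snd).indicator
      (measurableSet_le measurable_snd measurable_fst)).aemeasurable
  calc
    _ = ∫⁻ x, ∫⁻ t, r x * (Iic x).indicator g t ∂μ ∂μ := by
      refine setLIntegral_congr_fun measurableSet_Ioc fun x hx => ?_
      rw [lintegral_const_mul _ (hg.indicator measurableSet_Iic),
        lintegral_indicator measurableSet_Iic, hμ, Measure.restrict_restrict measurableSet_Iic,
        inter_comm, Ioc_inter_Iic, min_eq_right hx.2]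
    _ = ∫⁻ t, ∫⁻ x, r x * (Iic x).indicator g t ∂μ ∂μ := lintegral_lintegral_swap hmeas
    _ = _ := by
      refine setLIntegral_congr_fun measurableSet_Ioc fun t ht => ?_
      have : (fun x => r x * (Iic x).indicator g t) =
          fun x => (Ici t).indicator r x * g t := by
        ext x
        by_cases h : t ≤ x <;> simp [indicator, h]
      rw [this, lintegral_mul_const'' _ (hr.indicator measurableSet_Ici),
        lintegral_indicator measurableSet_Ici, hμ, Measure.restrict_restrict measurableSet_Ici]
      have : (Ici t ∩ Ioc a b : Set ℝ) = Icc t b := by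
        ext x
        simp only [mem_inter_iff, mem_Ici, mem_Ioc, mem_Icc]
        exact ⟨fun h => ⟨h.1, h.2.2⟩, fun h => ⟨h.1, ht.1.trans_le h.1, h.2⟩⟩
      rw [this, setLIntegral_congr Ioc_ae_eq_Icc]

/-- Theorem 2.18: For positive continuous `r` on `(a,b)`, an integer `p ≥ 0`, and
nonnegative measurable `f` (all integrals existing and finite),
`∫_a^b r(x)(∫_a^x f)^(p+1) dx ≤ (b−a)^p · ∫_a^b R(x,b) f(x)^(p+1) dx`,
where `R(x,b) = ∫_x^b r(t) dt`. -/
theorem hardy_type_thm_2_18 (a b : ℝ) (hab : a < b) (p : ℕ) (r f : ℝ → ℝ)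
    (hr : ContinuousOn r (Ioo a b)) (hrpos : ∀ x ∈ Ioo a b, 0 < r x)
    (hfmeas : Measurable f) (hfnonneg : ∀ x ∈ Ioo a b, 0 ≤ f x)
    (hfi : IntervalIntegrable f volume a b)
    (hri : IntervalIntegrable r volume a b)
    (h1 : IntervalIntegrable (fun x => r x * (∫ t in a..x, f t) ^ (p + 1)) volume a b)
    (h2 : IntervalIntegrable (fun x => (∫ t in x..b, r t) * f x ^ (p + 1)) volume a b) :
    ∫ x in a..b, r x * (∫ t in a..x, f t) ^ (p + 1) ≤
      (b - a) ^ p * ∫ x in a..b, (∫ t in x..b, r t) * f x ^ (p + 1) := by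
  have ae_Ioo : ∀ {c d : ℝ}, ∀ᵐ x ∂volume.restrict (Ioc c d), x ∈ Ioo c d := by
    intro c d
    rw [← Measure.restrict_congr_set Ioo_ae_eq_Ioc]
    exact ae_restrict_mem measurableSet_Ioo
  have hF : ∀ x ∈ Ioo a b,
      ENNReal.ofReal (∫ t in a..x, f t) = ∫⁻ t in Ioc a x, ENNReal.ofReal (f t) := by
    intro x hx
    rw [integral_of_le hx.1.le]
    refine ofReal_integral_eq_lintegral_ofReal
      (hfi.1.mono_set (Ioc_subset_Ioc_right hx.2.le)) ?_
    filter_upwards [ae_Ioo] with t ht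
    exact hfnonneg t ⟨ht.1, ht.2.trans hx.2⟩
  have hR : ∀ x ∈ Ioo a b,
      ENNReal.ofReal (∫ t in x..b, r t) = ∫⁻ t in Ioc x b, ENNReal.ofReal (r t) := by
    intro x hx
    rw [integral_of_le hx.2.le]
    refine ofReal_integral_eq_lintegral_ofReal
      (hri.1.mono_set (Ioc_subset_Ioc_left hx.1.le)) ?_
    filter_upwards [ae_Ioo] with t ht
    exact (hrpos t ⟨hx.1.trans ht.1, ht.2⟩).le
  have hF0 : ∀ x ∈ Ioo a b, 0 ≤ ∫ t in a..x, f t := fun x hx =>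
    integral_nonneg_of_ae_restrict hx.1.le (by
      rw [← Measure.restrict_congr_set Ioo_ae_eq_Icc]
      filter_upwards [ae_restrict_mem measurableSet_Ioo] with t ht
      exact hfnonneg t ⟨ht.1, ht.2.trans hx.2⟩)
  have hR0 : ∀ x ∈ Ioo a b, 0 ≤ ∫ t in x..b, r t := fun x hx =>
    integral_nonneg_of_ae_restrict hx.2.le (by
      rw [← Measure.restrict_congr_set Ioo_ae_eq_Icc]
      filter_upwards [ae_restrict_mem measurableSet_Ioo] with t ht
      exact (hrpos t ⟨hx.1.trans ht.1, ht.2⟩).le)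
  have hint0 : ∀ᵐ x ∂volume.restrict (Ioc a b), 0 ≤ (∫ t in x..b, r t) * f x ^ (p + 1) := by
    filter_upwards [ae_Ioo] with x hx
    exact mul_nonneg (hR0 x hx) (pow_nonneg (hfnonneg x hx) _)
  have hba : 0 ≤ (b - a) ^ p := pow_nonneg (sub_nonneg.2 hab.le) _
  rw [integral_of_le hab.le, integral_of_le hab.le]
  rw [← ENNReal.ofReal_le_ofReal_iff (mul_nonneg hba (integral_nonneg_of_ae hint0)),
    ENNReal.ofReal_mul hba, ofReal_integral_eq_lintegral_ofReal h2.1 hint0,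
    ofReal_integral_eq_lintegral_ofReal h1.1 (by
      filter_upwards [ae_Ioo] with x hx
      exact mul_nonneg (hrpos x hx).le (pow_nonneg (hF0 x hx) _))]
  calc
    _ ≤ ∫⁻ x in Ioc a b, ENNReal.ofReal ((b - a) ^ p) *
          (ENNReal.ofReal (r x) * ∫⁻ t in Ioc a x, ENNReal.ofReal (f t) ^ (p + 1)) := by
      refine lintegral_mono_ae ?_
      filter_upwards [ae_Ioo] with x hx
      rw [ENNReal.ofReal_mul (hrpos x hx).le, ENNReal.ofReal_pow (hF0 x hx), hF x hx,
        mul_left_comm]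
      gcongr
      refine (lintegral_pow_succ_le _ p hfmeas.ennreal_ofReal.aemeasurable).trans ?_
      rw [Measure.restrict_apply_univ, Real.volume_Ioc,
        ENNReal.ofReal_pow (sub_nonneg.2 hab.le)]
      gcongr
      exact hx.2.le
    _ = ENNReal.ofReal ((b - a) ^ p) * ∫⁻ t in Ioc a b,
          (∫⁻ x in Ioc t b, ENNReal.ofReal (r x)) * ENNReal.ofReal (f t) ^ (p + 1) := by
      rw [lintegral_const_mul' _ _ ENNReal.ofReal_ne_top, lintegral_mul_lintegral_Ioc_swap a b
        hri.1.aestronglyMeasurable.aemeasurable.ennreal_ofReal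
        (hfmeas.ennreal_ofReal.pow_const _)]
    _ = _ := by
      congr 1
      refine lintegral_congr_ae ?_
      filter_upwards [ae_Ioo] with x hx
      rw [ENNReal.ofReal_mul (hR0 x hx), hR x hx, ENNReal.ofReal_pow (hfnonneg x hx)]
end

section
/- Let a < X ≤ b be real numbers, let p and q be positive real numbers with p + q > 1, and let r and s be positive continuous functions on (a,b) with ∫_a^b s(t)^{−1/(p+q−1)} dt < ∞. If y : [a,b] → ℝ is absolutely continuous (differentiable with integrable derivative) and y(a) = 0, then ∫_a^X r(x)|y(x)|^p |y′(x)|^q dx ≤ K₁(a,X,p,q) · ∫_a^X s(x)|y′(x)|^{p+q} dx, where K₁(a,X,p,q) = (q/(p+q))^{q/(p+q)} · ( ∫_a^X r(x)^{(p+q)/p} s(x)^{−q/p} (∫_a^x s(t)^{−1/(p+q−1)} dt)^{p+q−1} dx )^{p/(p+q)}. -/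
open MeasureTheory intervalIntegral Set

/-- A `rpow` of exponent `α` of a nonnegative integrable function lies in `L^(1/α)`. -/
lemma MeasureTheory.Integrable.memLp_rpow {Ω : Type*} [MeasurableSpace Ω] {μ : Measure Ω}
    {u : Ω → ℝ} (hu : Integrable u μ) (hu0 : 0 ≤ᵐ[μ] u) {α : ℝ} (hα : 0 < α) :
    MemLp (fun x => u x ^ α) (ENNReal.ofReal (1 / α)) μ := by
  have h := (memLp_one_iff_integrable.2 hu).norm_rpow_div (ENNReal.ofReal α)
  rw [ENNReal.toReal_ofReal hα.le] at h
  rw [ENNReal.ofReal_div_of_pos hα, ENNReal.ofReal_one]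
  refine h.ae_eq ?_
  filter_upwards [hu0] with x hx
  rw [Real.norm_of_nonneg hx]

/-- Hölder's inequality for powers of integrable functions, with integrability of the product. -/
lemma MeasureTheory.integrable_and_integral_rpow_mul_rpow_le {Ω : Type*} [MeasurableSpace Ω]
    {μ : Measure Ω} {u v : Ω → ℝ} (hu : Integrable u μ) (hv : Integrable v μ)
    (hu0 : 0 ≤ᵐ[μ] u) (hv0 : 0 ≤ᵐ[μ] v) {α β : ℝ} (hα : 0 < α) (hβ : 0 < β) (hαβ : α + β = 1) :
    Integrable (fun x => u x ^ α * v x ^ β) μ ∧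
      ∫ x, u x ^ α * v x ^ β ∂μ ≤ (∫ x, u x ∂μ) ^ α * (∫ x, v x ∂μ) ^ β := by
  have hconj : (1 / α).HolderConjugate (1 / β) := by
    rw [Real.holderConjugate_iff]
    refine ⟨by rw [lt_div_iff₀ hα]; linarith, by simpa using hαβ⟩
  have mu := hu.memLp_rpow hu0 hα
  have mv := hv.memLp_rpow hv0 hβ
  have hu' : 0 ≤ᵐ[μ] fun x => u x ^ α := by
    filter_upwards [hu0] with x hx using Real.rpow_nonneg hx _
  have hv' : 0 ≤ᵐ[μ] fun x => v x ^ β := by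
    filter_upwards [hv0] with x hx using Real.rpow_nonneg hx _
  have hconj' : (ENNReal.ofReal (1 / α)).HolderConjugate (ENNReal.ofReal (1 / β)) :=
    hconj.ennrealOfReal
  refine ⟨mu.integrable_mul mv, ?_⟩
  have h := integral_mul_le_Lp_mul_Lq_of_nonneg hconj hu' hv' mu mv
  have eu : ∫ x, (u x ^ α) ^ (1 / α) ∂μ = ∫ x, u x ∂μ := by
    refine integral_congr_ae ?_
    filter_upwards [hu0] with x hx
    rw [← Real.rpow_mul hx, mul_one_div_cancel hα.ne', Real.rpow_one]
  have ev : ∫ x, (v x ^ β) ^ (1 / β) ∂μ = ∫ x, v x ∂μ := by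
    refine integral_congr_ae ?_
    filter_upwards [hv0] with x hx
    rw [← Real.rpow_mul hx, mul_one_div_cancel hβ.ne', Real.rpow_one]
  rwa [eu, ev, one_div_one_div, one_div_one_div] at h

/-- A Lipschitz function of an absolutely continuous function is absolutely continuous. -/
lemma LipschitzOnWith.comp_absolutelyContinuousOnInterval {f g : ℝ → ℝ} {a b : ℝ} {t : Set ℝ}
    {L : NNReal} (hg : LipschitzOnWith L g t) (hf : AbsolutelyContinuousOnInterval f a b)
    (hft : MapsTo f (uIcc a b) t) : AbsolutelyContinuousOnInterval (fun x => g (f x)) a b := by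
  have h := Filter.Tendsto.const_mul (L : ℝ) hf
  rw [mul_zero] at h
  refine squeeze_zero' (Filter.Eventually.of_forall fun E =>
    Finset.sum_nonneg fun _ _ => dist_nonneg) ?_ h
  refine Filter.eventually_inf_principal.2 (Filter.Eventually.of_forall fun E hE => ?_)
  rw [Finset.mul_sum]
  exact Finset.sum_le_sum fun i hi =>
    hg.dist_le_mul _ (hft (hE.1 i hi).1) _ (hft (hE.1 i hi).2)

/-- The power rule for the primitive of a nonnegative integrable function. -/
lemma intervalIntegral.integrable_and_integral_rpow_primitive_mul {g : ℝ → ℝ} {a b k : ℝ}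
    (hab : a ≤ b) (hg : IntervalIntegrable g volume a b)
    (hg0 : ∀ x ∈ Ioo a b, 0 ≤ g x) (hk : 0 < k) :
    IntervalIntegrable (fun x => (∫ t in a..x, g t) ^ k * g x) volume a b ∧
      ∫ x in a..b, (∫ t in a..x, g t) ^ k * g x = (∫ t in a..b, g t) ^ (k + 1) / (k + 1) := by
  set z : ℝ → ℝ := fun x => ∫ t in a..x, g t with hz
  have zac : AbsolutelyContinuousOnInterval z a b :=
    hg.absolutelyContinuousOnInterval_intervalIntegral left_mem_uIcc
  have zcont : ContinuousOn z (uIcc a b) := zac.continuousOn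
  have z0 : ∀ x ∈ uIcc a b, 0 ≤ z x := by
    intro x hx
    rw [uIcc_of_le hab] at hx
    refine integral_nonneg_of_ae_restrict hx.1 ?_
    rw [← restrict_Ioo_eq_restrict_Icc]
    exact ae_restrict_of_forall_mem measurableSet_Ioo
      fun t ht => hg0 t ⟨ht.1, ht.2.trans_le hx.2⟩
  have hint : IntervalIntegrable (fun x => z x ^ k * g x) volume a b :=
    hg.continuousOn_mul (zcont.rpow_const fun _ _ => Or.inr hk.le)
  refine ⟨hint, ?_⟩
  obtain ⟨C, hC⟩ := zac.exists_bound
  have hcd : ContDiff ℝ 1 fun u : ℝ => u ^ (k + 1) :=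
    Real.contDiff_rpow_const_of_le (by norm_num; exact hk.le)
  obtain ⟨L, hL⟩ := hcd.contDiffOn.exists_lipschitzOnWith (s := Icc (-C) C) one_ne_zero
    (convex_Icc _ _) isCompact_Icc
  have hW : AbsolutelyContinuousOnInterval (fun x => z x ^ (k + 1)) a b :=
    hL.comp_absolutelyContinuousOnInterval zac fun x hx => abs_le.1 (hC x hx)
  have hFTC := hW.integral_deriv_eq_sub
  have hder : ∫ x in a..b, deriv (fun x => z x ^ (k + 1)) x =
      ∫ x in a..b, (k + 1) * (z x ^ k * g x) := by
    refine integral_congr_ae ?_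
    filter_upwards [hg.ae_hasDerivAt_integral] with x hx hxab
    have hd : HasDerivAt z (g x) x := hx (uIoc_subset_uIcc hxab) a left_mem_uIcc
    have := hd.rpow_const (p := k + 1) (Or.inr (by linarith))
    rw [this.deriv, add_sub_cancel_right]
    ring
  have za : z a = 0 := integral_same
  rw [hder, intervalIntegral.integral_const_mul, za, Real.zero_rpow (by positivity), sub_zero]
    at hFTC
  rw [eq_div_iff (by positivity), ← hFTC]
  ring

/-- A weighted Hölder bound for the integral of `|f|` over an interval. -/
lemma intervalIntegral.integral_abs_le_of_weight {s f : ℝ → ℝ} {a x m : ℝ} (hax : a ≤ x)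
    (hm : 1 < m) (hspos : ∀ t ∈ Ioo a x, 0 < s t)
    (hs : IntervalIntegrable (fun t => s t ^ (-1 / (m - 1))) volume a x)
    (hf : IntervalIntegrable (fun t => s t * |f t| ^ m) volume a x) :
    ∫ t in a..x, |f t| ≤
      (∫ t in a..x, s t ^ (-1 / (m - 1))) ^ ((m - 1) / m) *
        (∫ t in a..x, s t * |f t| ^ m) ^ (1 / m) := by
  have hm0 : 0 < m := by linarith
  have hm1 : 0 < m - 1 := by linarith
  rw [intervalIntegrable_iff_integrableOn_Ioo_of_le hax] at hs hf
  simp only [integral_of_le hax, integral_Ioc_eq_integral_Ioo]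
  have key := (integrable_and_integral_rpow_mul_rpow_le hs hf
    (ae_restrict_of_forall_mem measurableSet_Ioo fun t ht => Real.rpow_nonneg (hspos t ht).le _)
    (ae_restrict_of_forall_mem measurableSet_Ioo fun t ht =>
      mul_nonneg (hspos t ht).le (by positivity))
    (α := (m - 1) / m) (β := 1 / m) (by positivity) (by positivity) (by field_simp; ring)).2
  refine le_trans (le_of_eq ?_) key
  refine setIntegral_congr_fun measurableSet_Ioo fun t ht => ?_
  have hst := hspos t ht
  have h : (-1 / (m - 1)) * ((m - 1) / m) + 1 / m = 0 := by field_simp; ring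
  rw [Real.mul_rpow hst.le (by positivity), ← Real.rpow_mul hst.le,
    ← Real.rpow_mul (abs_nonneg _), mul_one_div_cancel hm0.ne', Real.rpow_one, ← mul_assoc,
    ← Real.rpow_add hst, h, Real.rpow_zero, one_mul]

/-- Theorem 2.24 (Opial-type inequality of Beesack–Das): let `a < X ≤ b`, let
`p, q > 0` with `p + q > 1`, and let `r, s` be positive continuous functions on
`(a,b)` with `∫_a^b s(t)^(−1/(p+q−1)) dt < ∞`. If `y` is absolutely continuous on
`[a,b]` (with a.e. derivative `y'` and `y(x) = ∫_a^x y'(t) dt`) and `y(a) = 0`, then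
`∫_a^X r|y|^p |y'|^q ≤ K₁(a,X,p,q) · ∫_a^X s|y'|^(p+q)`, where
`K₁(a,X,p,q) = (q/(p+q))^(q/(p+q)) ·
(∫_a^X r^((p+q)/p) s^(−q/p) (∫_a^x s^(−1/(p+q−1)))^(p+q−1) dx)^(p/(p+q))`. -/
theorem opial_type_thm_2_24 (a b X : ℝ) (haX : a < X) (hXb : X ≤ b)
    (p q : ℝ) (hp : 0 < p) (hq : 0 < q) (hpq : 1 < p + q) (r s : ℝ → ℝ)
    (hr : ContinuousOn r (Ioo a b)) (hrpos : ∀ x ∈ Ioo a b, 0 < r x)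
    (hs : ContinuousOn s (Ioo a b)) (hspos : ∀ x ∈ Ioo a b, 0 < s x)
    (hsint : IntervalIntegrable (fun t => s t ^ (-1 / (p + q - 1))) volume a b)
    (y y' : ℝ → ℝ)
    (hy'int : IntervalIntegrable y' volume a b)
    (hAC : ∀ x ∈ Icc a b, y x = ∫ t in a..x, y' t)
    (hya : y a = 0)
    (h1 : IntervalIntegrable (fun x => r x * |y x| ^ p * |y' x| ^ q) volume a X)
    (h2 : IntervalIntegrable (fun x => s x * |y' x| ^ (p + q)) volume a X)
    (h3 : IntervalIntegrable (fun x => r x ^ ((p + q) / p) * s x ^ (-q / p) *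
      (∫ t in a..x, s t ^ (-1 / (p + q - 1))) ^ (p + q - 1)) volume a X) :
    ∫ x in a..X, r x * |y x| ^ p * |y' x| ^ q ≤
      ((q / (p + q)) ^ (q / (p + q)) *
          (∫ x in a..X, r x ^ ((p + q) / p) * s x ^ (-q / p) *
            (∫ t in a..x, s t ^ (-1 / (p + q - 1))) ^ (p + q - 1)) ^ (p / (p + q))) *
        ∫ x in a..X, s x * |y' x| ^ (p + q) := by
  have hm0 : 0 < p + q := by linarith
  have hm1 : 0 < p + q - 1 := by linarith
  have hsub : ∀ {x}, x ∈ Ioo a X → x ∈ Ioo a b := fun hx => ⟨hx.1, hx.2.trans_le hXb⟩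
  set S : ℝ → ℝ := fun x => ∫ t in a..x, s t ^ (-1 / (p + q - 1)) with hS
  set z : ℝ → ℝ := fun x => ∫ t in a..x, s t * |y' t| ^ (p + q) with hz
  have hz'0 : ∀ x ∈ Ioo a X, 0 ≤ s x * |y' x| ^ (p + q) := fun x hx =>
    mul_nonneg (hspos x (hsub hx)).le (by positivity)
  have hS0 : ∀ x ∈ Ioo a X, 0 ≤ S x := by
    intro x hx
    refine integral_nonneg_of_ae_restrict hx.1.le ?_
    rw [← restrict_Ioo_eq_restrict_Icc]
    exact ae_restrict_of_forall_mem measurableSet_Ioo fun t ht =>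
      Real.rpow_nonneg (hspos t (hsub ⟨ht.1, ht.2.trans hx.2⟩)).le _
  have hz0 : ∀ x ∈ Ioc a X, 0 ≤ z x := by
    intro x hx
    refine integral_nonneg_of_ae_restrict hx.1.le ?_
    rw [← restrict_Ioo_eq_restrict_Icc]
    exact ae_restrict_of_forall_mem measurableSet_Ioo fun t ht =>
      hz'0 t ⟨ht.1, ht.2.trans_le hx.2⟩
  have hy : ∀ x ∈ Ioo a X, |y x| ≤ S x ^ ((p + q - 1) / (p + q)) * z x ^ (1 / (p + q)) := by
    intro x hx
    have hxab : x ∈ Icc a b := ⟨hx.1.le, (hsub hx).2.le⟩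
    rw [hAC x hxab]
    refine (abs_integral_le_integral_abs hx.1.le).trans ?_
    refine integral_abs_le_of_weight hx.1.le hpq
      (fun t ht => hspos t (hsub ⟨ht.1, ht.2.trans hx.2⟩))
      (hsint.mono_set ?_) (h2.mono_set ?_)
    · rw [uIcc_of_le hx.1.le, uIcc_of_le (haX.le.trans hXb)]
      exact Icc_subset_Icc_right hxab.2
    · rw [uIcc_of_le hx.1.le, uIcc_of_le haX.le]
      exact Icc_subset_Icc_right hx.2.le
  obtain ⟨hzint, hzeq⟩ := integrable_and_integral_rpow_primitive_mul haX.le h2 hz'0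
    (k := p / q) (by positivity)
  have hzX : 0 ≤ z X := hz0 X ⟨haX, le_rfl⟩
  have hconst : (∫ x in a..X, z x ^ (p / q) * (s x * |y' x| ^ (p + q))) ^ (q / (p + q)) =
      (q / (p + q)) ^ (q / (p + q)) * z X := by
    have e1 : p / q + 1 = (p + q) / q := by field_simp
    have e2 : (p + q) / q * (q / (p + q)) = 1 := by field_simp
    rw [hzeq, e1, div_eq_mul_inv, inv_div, mul_comm,
      Real.mul_rpow (by positivity) (Real.rpow_nonneg hzX _), ← Real.rpow_mul hzX, e2,
      Real.rpow_one]
  have hmain : ∫ x in a..X, r x * |y x| ^ p * |y' x| ^ q ≤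
      (∫ x in a..X, r x ^ ((p + q) / p) * s x ^ (-q / p) * S x ^ (p + q - 1)) ^ (p / (p + q)) *
      (∫ x in a..X, z x ^ (p / q) * (s x * |y' x| ^ (p + q))) ^ (q / (p + q)) := by
    rw [intervalIntegrable_iff_integrableOn_Ioo_of_le haX.le] at h1 h3 hzint
    simp only [integral_of_le haX.le, integral_Ioc_eq_integral_Ioo]
    obtain ⟨hint, hle⟩ := integrable_and_integral_rpow_mul_rpow_le h3 hzint
      (ae_restrict_of_forall_mem measurableSet_Ioo fun x hx =>
        mul_nonneg (mul_nonneg (Real.rpow_nonneg (hrpos x (hsub hx)).le _)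
          (Real.rpow_nonneg (hspos x (hsub hx)).le _)) (Real.rpow_nonneg (hS0 x hx) _))
      (ae_restrict_of_forall_mem measurableSet_Ioo fun x hx =>
        mul_nonneg (Real.rpow_nonneg (hz0 x ⟨hx.1, hx.2.le⟩) _) (hz'0 x hx))
      (α := p / (p + q)) (β := q / (p + q)) (by positivity) (by positivity) (by field_simp)
    refine (setIntegral_mono_on h1 hint measurableSet_Ioo fun x hx => ?_).trans hle
    have hrx := hrpos x (hsub hx)
    have hsx := hspos x (hsub hx)
    have hSx := hS0 x hx
    have hzx := hz0 x ⟨hx.1, hx.2.le⟩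
    have hyp : |y x| ^ p ≤ S x ^ ((p + q - 1) * (p / (p + q))) * z x ^ (p / (p + q)) := by
      refine (Real.rpow_le_rpow (abs_nonneg _) (hy x hx) hp.le).trans (le_of_eq ?_)
      rw [Real.mul_rpow (by positivity) (by positivity), ← Real.rpow_mul hSx,
        ← Real.rpow_mul hzx]
      congr 2 <;> ring
    have e1 : (p + q) / p * (p / (p + q)) = 1 := by field_simp
    have e2 : -q / p * (p / (p + q)) + q / (p + q) = 0 := by field_simp; ring
    have e3 : p / q * (q / (p + q)) = p / (p + q) := by field_simp
    have e4 : (p + q) * (q / (p + q)) = q := by field_simp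
    calc r x * |y x| ^ p * |y' x| ^ q
        ≤ r x * (S x ^ ((p + q - 1) * (p / (p + q))) * z x ^ (p / (p + q))) * |y' x| ^ q := by
          gcongr
      _ = r x * (s x ^ (-q / p * (p / (p + q))) * s x ^ (q / (p + q))) *
            (S x ^ ((p + q - 1) * (p / (p + q))) * z x ^ (p / (p + q))) * |y' x| ^ q := by
          rw [← Real.rpow_add hsx, e2, Real.rpow_zero, mul_one]
      _ = _ := by
          change _ = (r x ^ ((p + q) / p) * s x ^ (-q / p) * S x ^ (p + q - 1)) ^ (p / (p + q)) *
            (z x ^ (p / q) * (s x * |y' x| ^ (p + q))) ^ (q / (p + q))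
          rw [Real.mul_rpow (by positivity) (by positivity),
            Real.mul_rpow (by positivity) (by positivity),
            Real.mul_rpow (by positivity) (by positivity),
            Real.mul_rpow (by positivity) (by positivity),
            ← Real.rpow_mul hrx.le, ← Real.rpow_mul hsx.le, ← Real.rpow_mul hSx,
            ← Real.rpow_mul hzx, ← Real.rpow_mul (abs_nonneg _), e1, e3, e4, Real.rpow_one]
          ring
  rw [hconst] at hmain
  refine hmain.trans (le_of_eq ?_)
  ring
end
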